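/- arXiv:2405.05415 — 4 statements merged into one kernel-verified Lean document; each statement's English description precedes it below -/
import Mathlib

section
/- Let Ω ⊂ ℝ² be a convex bounded set with nonempty interior such that at least one of its two vertical support lines (lines parallel to the y-axis) is not angular. Then the supremum, over all nonzero functions u in U_Ω, of the ratio (∫_Ω u_x² dx dy)/(∫_Ω u_y² dx dy) is +∞. -/
open MeasureTheory Real Set Filter Asymptotics

/-- The partial derivative `u_x` (defined via the full derivative; `0` where `u` is
not differentiable). -/
noncomputable def uX (u : ℝ × ℝ → ℝ) (p : ℝ × ℝ) : ℝ := fderiv ℝ u p (1, 0)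

/-- The partial derivative `u_y`. -/
noncomputable def uY (u : ℝ × ℝ → ℝ) (p : ℝ × ℝ) : ℝ := fderiv ℝ u p (0, 1)

/-- Membership in the class `U_Ω`: continuous concave functions on `Ω`, differentiable
almost everywhere, with bounded gradient, vanishing on `∂Ω`. -/
def MemU (Ω : Set (ℝ × ℝ)) (u : ℝ × ℝ → ℝ) : Prop :=
  ContinuousOn u (closure Ω) ∧ ConcaveOn ℝ Ω u ∧
    (∀ᵐ p ∂(volume.restrict Ω), DifferentiableAt ℝ u p) ∧
    (∃ C : ℝ, ∀ p ∈ Ω, DifferentiableAt ℝ u p → ‖fderiv ℝ u p‖ ≤ C) ∧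
    (∀ p ∈ frontier Ω, u p = 0)

/-- `∫_Ω u_x² dx dy`. -/
noncomputable def Ix (Ω : Set (ℝ × ℝ)) (u : ℝ × ℝ → ℝ) : ℝ := ∫ p in Ω, (uX u p) ^ 2

/-- `∫_Ω u_y² dx dy`. -/
noncomputable def Iy (Ω : Set (ℝ × ℝ)) (u : ℝ × ℝ → ℝ) : ℝ := ∫ p in Ω, (uY u p) ^ 2

/-- The abscissa of the left vertical support line of `Ω`. -/
noncomputable def leftX (Ω : Set (ℝ × ℝ)) : ℝ := sInf (Prod.fst '' Ω)

/-- The abscissa of the right vertical support line of `Ω`. -/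
noncomputable def rightX (Ω : Set (ℝ × ℝ)) : ℝ := sSup (Prod.fst '' Ω)

/-- The vertical support line `{x = x₀}` of `Ω`, touching `Ω` at the contact point
`(x₀, p₂)`, is angular: every `(x,y) ∈ Ω` satisfies `|y - p₂| ≤ C|x - x₀|`. -/
def AngularSupportAt (Ω : Set (ℝ × ℝ)) (x₀ : ℝ) : Prop :=
  ∃ p₂ : ℝ, (x₀, p₂) ∈ closure Ω ∧ ∃ C > 0, ∀ q ∈ Ω, |q.2 - p₂| ≤ C * |q.1 - x₀|

/-- The `C¹` norm `sup |u| + sup |u_x| + sup |u_y|`, the suprema over the derivatives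
being taken over the points where they exist. -/
noncomputable def C1Norm (Ω : Set (ℝ × ℝ)) (u : ℝ × ℝ → ℝ) : ℝ :=
  sSup ((fun p => |u p|) '' Ω) +
    sSup ((fun p => |uX u p|) '' {p ∈ Ω | DifferentiableAt ℝ u p}) +
    sSup ((fun p => |uY u p|) '' {p ∈ Ω | DifferentiableAt ℝ u p})

/-- The resistance functional `F(u) = ∫_Ω f(∇u) dx dy`. -/
noncomputable def Fres (Ω : Set (ℝ × ℝ)) (f : ℝ × ℝ → ℝ) (u : ℝ × ℝ → ℝ) : ℝ :=
  ∫ p in Ω, f (uX u p, uY u p)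

/-- The zero function is a local minimum of `F` on `U_Ω` in the `C¹` norm. -/
def ZeroIsLocalMin (Ω : Set (ℝ × ℝ)) (f : ℝ × ℝ → ℝ) : Prop :=
  ∃ δ : ℝ, 0 < δ ∧ ∀ u : ℝ × ℝ → ℝ, MemU Ω u → C1Norm Ω u < δ →
    Fres Ω f (fun _ => 0) ≤ Fres Ω f u

/-- `n` is an outward normal of a support line to `Ω` at `ξ`. -/
def IsSupportDir (Ω : Set (ℝ × ℝ)) (ξ n : ℝ × ℝ) : Prop :=
  n ≠ 0 ∧ ∀ q ∈ Ω, n.1 * q.1 + n.2 * q.2 ≤ n.1 * ξ.1 + n.2 * ξ.2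

/-- `ξ` is a regular boundary point: the support line at `ξ` is unique. -/
def IsRegularPoint (Ω : Set (ℝ × ℝ)) (ξ : ℝ × ℝ) : Prop :=
  ξ ∈ frontier Ω ∧
    ∀ n m : ℝ × ℝ, IsSupportDir Ω ξ n → IsSupportDir Ω ξ m → ∃ t : ℝ, m = t • n

/-- `ξ` is a singular boundary point: `Ω` has more than one support line at `ξ`. -/
def IsSingularPoint (Ω : Set (ℝ × ℝ)) (ξ : ℝ × ℝ) : Prop :=
  ξ ∈ frontier Ω ∧
    ∃ n m : ℝ × ℝ, IsSupportDir Ω ξ n ∧ IsSupportDir Ω ξ m ∧ ¬∃ t : ℝ, m = t • n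

/-- The pairing of a gradient with a displacement. -/
def pair (g v : ℝ × ℝ) : ℝ := g.1 * v.1 + g.2 * v.2

/-- Gradients of the affine functions that equal `1` at `a` and are nonnegative on `Ω`. -/
def roofGrads (Ω : Set (ℝ × ℝ)) (a : ℝ × ℝ) : Set (ℝ × ℝ) :=
  {g | ∀ x ∈ Ω, 0 ≤ 1 + pair g (x - a)}

/-- The least concave function over `Ω` that vanishes on the boundary and equals `1` at `a`. -/
noncomputable def roof (Ω : Set (ℝ × ℝ)) (a p : ℝ × ℝ) : ℝ :=
  sInf ((fun g => 1 + pair g (p - a)) '' roofGrads Ω a)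

lemma continuous_pair : Continuous fun z : (ℝ × ℝ) × (ℝ × ℝ) => pair z.1 z.2 := by
  unfold pair; fun_prop

lemma pair_sub_right (g v w : ℝ × ℝ) : pair g (v - w) = pair g v - pair g w := by
  simp only [pair, Prod.fst_sub, Prod.snd_sub]; ring

lemma pair_add_right (g v w : ℝ × ℝ) : pair g (v + w) = pair g v + pair g w := by
  simp only [pair, Prod.fst_add, Prod.snd_add]; ring

lemma pair_smul_right (g v : ℝ × ℝ) (t : ℝ) : pair g (t • v) = t * pair g v := by
  simp only [pair, Prod.smul_fst, Prod.smul_snd, smul_eq_mul]; ring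

lemma abs_pair_le (g v : ℝ × ℝ) : |pair g v| ≤ 2 * ‖g‖ * ‖v‖ := by
  have h1 : |g.1 * v.1| ≤ ‖g‖ * ‖v‖ := by
    rw [abs_mul]; exact mul_le_mul (norm_fst_le g) (norm_fst_le v) (abs_nonneg _) (norm_nonneg _)
  have h2 : |g.2 * v.2| ≤ ‖g‖ * ‖v‖ := by
    rw [abs_mul]; exact mul_le_mul (norm_snd_le g) (norm_snd_le v) (abs_nonneg _) (norm_nonneg _)
  have := abs_add_le (g.1 * v.1) (g.2 * v.2)
  unfold pair; linarith

lemma zero_mem_roofGrads (Ω : Set (ℝ × ℝ)) (a : ℝ × ℝ) : (0 : ℝ × ℝ) ∈ roofGrads Ω a := by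
  intro x _; simp [pair]

lemma exists_bound_roofGrads {Ω : Set (ℝ × ℝ)} {a : ℝ × ℝ} (ha : a ∈ interior Ω) :
    ∃ C : ℝ, ∀ g ∈ roofGrads Ω a, ‖g‖ ≤ C := by
  obtain ⟨ρ, hρ, hb⟩ := Metric.isOpen_iff.1 isOpen_interior a ha
  have hmem : ∀ v : ℝ × ℝ, |v.1| ≤ ρ / 2 → |v.2| ≤ ρ / 2 → a + v ∈ Ω := by
    intro v h1 h2
    apply interior_subset (hb _)
    rw [Metric.mem_ball, dist_eq_norm, add_sub_cancel_left, Prod.norm_def]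
    exact max_lt (by rw [Real.norm_eq_abs]; linarith) (by rw [Real.norm_eq_abs]; linarith)
  have hp : |ρ / 2| ≤ ρ / 2 := (abs_of_pos (by positivity)).le
  have hm : |-(ρ / 2)| ≤ ρ / 2 := by rw [abs_neg]; exact hp
  have hz : |(0 : ℝ)| ≤ ρ / 2 := by rw [abs_zero]; positivity
  refine ⟨2 / ρ, fun g hg => ?_⟩
  have e1 := hg _ (hmem (ρ / 2, 0) hp hz)
  have e2 := hg _ (hmem (-(ρ / 2), 0) hm hz)
  have e3 := hg _ (hmem (0, ρ / 2) hz hp)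
  have e4 := hg _ (hmem (0, -(ρ / 2)) hz hm)
  simp only [pair, add_sub_cancel_left] at e1 e2 e3 e4
  rw [Prod.norm_def]
  refine max_le ?_ ?_ <;> rw [Real.norm_eq_abs, abs_le] <;> constructor
  · rw [← neg_div, div_le_iff₀ hρ]; linarith
  · rw [le_div_iff₀ hρ]; linarith
  · rw [← neg_div, div_le_iff₀ hρ]; linarith
  · rw [le_div_iff₀ hρ]; linarith

lemma isCompact_roofGrads {Ω : Set (ℝ × ℝ)} {a : ℝ × ℝ} (ha : a ∈ interior Ω) :
    IsCompact (roofGrads Ω a) := by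
  obtain ⟨C, hC⟩ := exists_bound_roofGrads ha
  refine Metric.isCompact_of_isClosed_isBounded ?_
    (isBounded_iff_forall_norm_le.2 ⟨C, hC⟩)
  have : roofGrads Ω a = ⋂ x ∈ Ω, {g | 0 ≤ 1 + pair g (x - a)} := by
    ext g; simp [roofGrads]
  rw [this]
  refine isClosed_biInter fun x _ => isClosed_le continuous_const ?_
  exact continuous_const.add (continuous_pair.comp (continuous_id.prodMk continuous_const))

lemma exists_roof_eq {Ω : Set (ℝ × ℝ)} {a : ℝ × ℝ} (ha : a ∈ interior Ω) (p : ℝ × ℝ) :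
    ∃ g ∈ roofGrads Ω a, roof Ω a p = 1 + pair g (p - a) := by
  have hc : Continuous fun g : ℝ × ℝ => 1 + pair g (p - a) :=
    continuous_const.add (continuous_pair.comp (continuous_id.prodMk continuous_const))
  obtain ⟨g, hg, h⟩ := (isCompact_roofGrads ha).exists_sInf_image_eq
    ⟨0, zero_mem_roofGrads Ω a⟩ hc.continuousOn
  exact ⟨g, hg, h⟩

lemma roof_le {Ω : Set (ℝ × ℝ)} {a : ℝ × ℝ} (ha : a ∈ interior Ω) {g : ℝ × ℝ}
    (hg : g ∈ roofGrads Ω a) (p : ℝ × ℝ) : roof Ω a p ≤ 1 + pair g (p - a) := by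
  have hc : Continuous fun g : ℝ × ℝ => 1 + pair g (p - a) :=
    continuous_const.add (continuous_pair.comp (continuous_id.prodMk continuous_const))
  exact csInf_le ((isCompact_roofGrads ha).image hc).bddBelow ⟨g, hg, rfl⟩

lemma roof_apex {Ω : Set (ℝ × ℝ)} {a : ℝ × ℝ} (ha : a ∈ interior Ω) : roof Ω a a = 1 := by
  obtain ⟨g, -, h⟩ := exists_roof_eq ha a
  simpa [pair] using h

lemma exists_lipschitzWith_roof {Ω : Set (ℝ × ℝ)} {a : ℝ × ℝ} (ha : a ∈ interior Ω) :
    ∃ K, LipschitzWith K (roof Ω a) := by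
  obtain ⟨C, hC⟩ := exists_bound_roofGrads ha
  refine ⟨(2 * C).toNNReal, LipschitzWith.of_le_add_mul' _ fun p q => ?_⟩
  obtain ⟨g, hg, h⟩ := exists_roof_eq ha q
  have h1 := roof_le ha hg p
  have h2 := (le_abs_self _).trans (abs_pair_le g (p - q))
  have h3 : 2 * ‖g‖ * ‖p - q‖ ≤ 2 * C * ‖p - q‖ := by gcongr; exact hC g hg
  rw [dist_eq_norm, h]
  have : pair g (p - q) = pair g (p - a) - pair g (q - a) := by simp only [pair_sub_right]; ring
  linarith

lemma concaveOn_roof {Ω : Set (ℝ × ℝ)} {a : ℝ × ℝ} (ha : a ∈ interior Ω) (hΩ : Convex ℝ Ω) :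
    ConcaveOn ℝ Ω (roof Ω a) := by
  refine ⟨hΩ, fun p _ q _ s t hs ht hst => ?_⟩
  obtain ⟨g, hg, h⟩ := exists_roof_eq ha (s • p + t • q)
  have h1 := mul_le_mul_of_nonneg_left (roof_le ha hg p) hs
  have h2 := mul_le_mul_of_nonneg_left (roof_le ha hg q) ht
  rw [h]
  simp only [pair_sub_right, pair_add_right, pair_smul_right, smul_eq_mul] at h1 h2 ⊢
  have : s * (1 + (pair g p - pair g a)) + t * (1 + (pair g q - pair g a))
      = (s + t) * (1 - pair g a) + (s * pair g p + t * pair g q) := by ring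
  rw [hst] at this
  linarith

/-- Wherever the roof is differentiable, its gradient is that of a minimizing affine function. -/
lemma exists_roof_gradient {Ω : Set (ℝ × ℝ)} {a : ℝ × ℝ} (ha : a ∈ interior Ω) {p : ℝ × ℝ}
    (hp : DifferentiableAt ℝ (roof Ω a) p) :
    ∃ g ∈ roofGrads Ω a, roof Ω a p = 1 + pair g (p - a) ∧
      uX (roof Ω a) p = g.1 ∧ uY (roof Ω a) p = g.2 := by
  obtain ⟨g, hg, h⟩ := exists_roof_eq ha p
  let L : ℝ × ℝ →L[ℝ] ℝ :=
    g.1 • ContinuousLinearMap.fst ℝ ℝ ℝ + g.2 • ContinuousLinearMap.snd ℝ ℝ ℝ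
  have hL : ∀ v, L v = pair g v := fun v => by simp [L, pair]
  have hmax : IsLocalMax (fun x => roof Ω a x - L x) p := by
    refine Eventually.of_forall fun x => ?_
    have := roof_le ha hg x
    simp only [hL, pair_sub_right] at *
    linarith
  have h0 := hmax.fderiv_eq_zero
  rw [fderiv_fun_sub hp L.differentiableAt, L.fderiv, sub_eq_zero] at h0
  refine ⟨g, hg, h, ?_, ?_⟩
  · rw [uX, h0, hL]; simp [pair]
  · rw [uY, h0, hL]; simp [pair]

lemma roof_eq_zero_of_mem_frontier {Ω : Set (ℝ × ℝ)} {a : ℝ × ℝ} (ha : a ∈ interior Ω)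
    (hΩ : Convex ℝ Ω) {p : ℝ × ℝ} (hp : p ∈ frontier Ω) : roof Ω a p = 0 := by
  apply le_antisymm
  · obtain ⟨f, hf⟩ := geometric_hahn_banach_open_point hΩ.interior isOpen_interior hp.2
    have hle : ∀ x ∈ Ω, f x ≤ f p := by
      intro x hx
      have hx' : x ∈ closure (interior Ω) := by
        rw [hΩ.closure_interior_eq_closure_of_nonempty_interior ⟨a, ha⟩]
        exact subset_closure hx
      exact closure_minimal (fun y hy => (hf y hy).le)
        (isClosed_le f.continuous continuous_const) hx'
    have hpos : 0 < f p - f a := sub_pos.2 (hf a ha)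
    have hfx : ∀ x : ℝ × ℝ, pair (-f (1, 0) / (f p - f a), -f (0, 1) / (f p - f a)) (x - a)
        = -(f x - f a) / (f p - f a) := by
      intro x
      have : x - a = (x - a).1 • ((1 : ℝ), (0 : ℝ)) + (x - a).2 • ((0 : ℝ), (1 : ℝ)) := by
        ext <;> simp
      have h2 := congrArg f this
      rw [map_sub, map_add, map_smul, map_smul, smul_eq_mul, smul_eq_mul] at h2
      rw [h2, pair]
      ring
    have hg : (-f (1, 0) / (f p - f a), -f (0, 1) / (f p - f a)) ∈ roofGrads Ω a := by
      intro x hx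
      rw [hfx]
      have : 1 + -(f x - f a) / (f p - f a) = (f p - f x) / (f p - f a) := by
        field_simp; ring
      rw [this]
      exact div_nonneg (sub_nonneg.2 (hle x hx)) hpos.le
    have := roof_le ha hg p
    rw [hfx, neg_div, div_self hpos.ne'] at this
    linarith
  · obtain ⟨g, hg, h⟩ := exists_roof_eq ha p
    rw [h]
    have hcl : IsClosed {x | 0 ≤ 1 + pair g (x - a)} :=
      isClosed_le continuous_const (continuous_const.add
        (continuous_pair.comp (continuous_const.prodMk (continuous_id.sub continuous_const))))
    exact closure_minimal hg hcl hp.1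

lemma memU_roof {Ω : Set (ℝ × ℝ)} {a : ℝ × ℝ} (ha : a ∈ interior Ω) (hΩ : Convex ℝ Ω) :
    MemU Ω (roof Ω a) := by
  obtain ⟨K, hK⟩ := exists_lipschitzWith_roof ha
  exact ⟨hK.continuous.continuousOn, concaveOn_roof ha hΩ,
    ae_restrict_of_ae hK.ae_differentiableAt,
    ⟨K, fun p _ _ => norm_fderiv_le_of_lipschitz ℝ hK⟩,
    fun p hp => roof_eq_zero_of_mem_frontier ha hΩ hp⟩

/-- A convex set that is steep at a vertical support line has an inscribed disc, touching the
boundary at `c + r • n`, with almost horizontal normal `n`. -/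
lemma exists_touching_disc {Ω : Set (ℝ × ℝ)} (hΩ : Convex ℝ Ω) (hint : (interior Ω).Nonempty)
    {x₀ : ℝ} (hx₀ : ∀ q ∈ interior Ω, q.1 ≠ x₀) {y₀ : ℝ} (hy₀ : (x₀, y₀) ∈ closure Ω)
    (hang : ¬ AngularSupportAt Ω x₀) {C : ℝ} (hC : 0 < C) :
    ∃ (c n : ℝ × ℝ) (r : ℝ), 0 < r ∧ n.1 ^ 2 + n.2 ^ 2 = 1 ∧ C * |n.2| < 2 ∧
      (∀ q : ℝ × ℝ, (q.1 - c.1) ^ 2 + (q.2 - c.2) ^ 2 < r ^ 2 → q ∈ interior Ω) ∧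
      (∀ q ∈ Ω, pair n (q - c) ≤ r) := by
  have hcl : closure (interior Ω) = closure Ω :=
    hΩ.closure_interior_eq_closure_of_nonempty_interior hint
  obtain ⟨q, hq, hqC⟩ : ∃ q ∈ interior Ω, C * |q.1 - x₀| < |q.2 - y₀| := by
    by_contra! h
    refine hang ⟨y₀, hy₀, C, hC, fun q hq => ?_⟩
    have hq' : q ∈ closure (interior Ω) := hcl ▸ subset_closure hq
    exact closure_minimal (t := {q : ℝ × ℝ | |q.2 - y₀| ≤ C * |q.1 - x₀|}) h
      (isClosed_le (by fun_prop) (by fun_prop)) hq'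
  set w : ℝ × ℝ := ((q.1 - x₀) / 2, (q.2 - y₀) / 2) with hw
  set c : ℝ × ℝ := ((q.1 + x₀) / 2, (q.2 + y₀) / 2) with hc
  have hcint : c ∈ interior Ω := by
    have := hΩ.combo_interior_closure_mem_interior hq hy₀ (a := 1 / 2) (b := 1 / 2)
      (by norm_num) (by norm_num) (by norm_num)
    convert this using 1
    ext <;> simp [hc] <;> ring
  have hX : q.1 - x₀ ≠ 0 := sub_ne_zero.2 (hx₀ q hq)
  -- the point of the complement of the interior that is closest to `c`
  let D : ℝ × ℝ → ℝ := fun p => (p.1 - c.1) ^ 2 + (p.2 - c.2) ^ 2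
  have hDc : Continuous D := by fun_prop
  let S : Set (ℝ × ℝ) := (interior Ω)ᶜ ∩ {p | D p ≤ w.1 ^ 2}
  have hz : ((x₀, c.2) : ℝ × ℝ) ∈ S := by
    refine ⟨fun h => hx₀ _ h rfl, ?_⟩
    simp only [D, mem_ofPred_eq, hc, hw]
    apply le_of_eq; ring
  have hScl : IsClosed S := isOpen_interior.isClosed_compl.inter (isClosed_le hDc continuous_const)
  have hSb : Bornology.IsBounded S := by
    refine (Metric.isBounded_closedBall (x := c) (r := |w.1|)).subset fun p hp => ?_
    have hp2 : (p.1 - c.1) ^ 2 + (p.2 - c.2) ^ 2 ≤ w.1 ^ 2 := hp.2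
    rw [Metric.mem_closedBall, dist_eq_norm, Prod.norm_def]
    refine max_le ?_ ?_ <;> rw [Real.norm_eq_abs, ← sq_le_sq]
    · have := sq_nonneg (p.2 - c.2); simp only [Prod.fst_sub]; linarith
    · have := sq_nonneg (p.1 - c.1); simp only [Prod.snd_sub]; linarith
  obtain ⟨P, hPS, hPmin⟩ := (Metric.isCompact_of_isClosed_isBounded hScl hSb).exists_isMinOn
    ⟨_, hz⟩ hDc.continuousOn
  have hdisc : ∀ p : ℝ × ℝ, D p < D P → p ∈ interior Ω := by
    intro p hp
    by_contra hpn
    exact absurd (hPmin (show p ∈ S from ⟨hpn, hp.le.trans hPS.2⟩)) (not_le.2 hp)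
  have hDP : 0 < D P := by
    rcases (add_nonneg (sq_nonneg (P.1 - c.1)) (sq_nonneg (P.2 - c.2))).lt_or_eq with h | h
    · exact h
    · exfalso
      have h1 : P.1 - c.1 = 0 := by nlinarith [sq_nonneg (P.1 - c.1), sq_nonneg (P.2 - c.2)]
      have h2 : P.2 - c.2 = 0 := by nlinarith [sq_nonneg (P.1 - c.1), sq_nonneg (P.2 - c.2)]
      have : P = c := Prod.ext (by linarith) (by linarith)
      exact hPS.1 (this ▸ hcint)
  set r := √(D P) with hr
  have hrpos : 0 < r := Real.sqrt_pos.2 hDP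
  have hr2 : r ^ 2 = D P := Real.sq_sqrt hDP.le
  have hDP' : D P = (P.1 - c.1) ^ 2 + (P.2 - c.2) ^ 2 := rfl
  -- the tangent line of the disc at `P` supports `Ω`
  have hsupp : ∀ x ∈ interior Ω, pair (P - c) (x - P) ≤ 0 := by
    intro x hx
    by_contra! hpos
    set k := pair (P - c) (x - P) with hk
    set N := (x.1 - P.1) ^ 2 + (x.2 - P.2) ^ 2 with hN
    have hN0 : 0 ≤ N := by positivity
    set e := k / (N + 1) with he
    have he0 : 0 < e := by positivity
    have heN : e * (N + 1) = k := by rw [he]; field_simp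
    have hy : P - e • (x - P) ∈ interior Ω := by
      apply hdisc
      have : D (P - e • (x - P)) = D P - 2 * e * k + e ^ 2 * N := by
        simp only [D, hk, hN, pair, Prod.fst_sub, Prod.snd_sub, Prod.smul_fst, Prod.smul_snd,
          smul_eq_mul]
        ring
      rw [this]
      nlinarith [mul_pos he0 hpos, mul_pos he0 he0]
    apply hPS.1
    have := hΩ.interior hx hy (a := e / (1 + e)) (b := 1 / (1 + e)) (by positivity)
      (by positivity) (by field_simp; ring)
    convert this using 1
    ext <;> simp <;> field_simp <;> ring
  have hsupp' : ∀ x ∈ closure Ω, pair (P - c) (x - P) ≤ 0 := by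
    rw [← hcl]
    exact closure_minimal hsupp (isClosed_le (continuous_pair.comp
      (continuous_const.prodMk (continuous_id.sub continuous_const))) continuous_const)
  have hn : ∀ x ∈ closure Ω, pair (r⁻¹ • (P - c)) (x - c) ≤ r := by
    intro x hx
    have h1 := hsupp' x hx
    have h2 : pair (r⁻¹ • (P - c)) (x - c) = r⁻¹ * (pair (P - c) (x - P) + r ^ 2) := by
      rw [hr2, hDP']
      simp only [pair, Prod.smul_fst, Prod.smul_snd, Prod.fst_sub, Prod.snd_sub, smul_eq_mul]
      ring
    rw [h2, inv_mul_le_iff₀ hrpos]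
    nlinarith
  have hunit : (r⁻¹ • (P - c)).1 ^ 2 + (r⁻¹ • (P - c)).2 ^ 2 = 1 := by
    simp only [Prod.smul_fst, Prod.smul_snd, Prod.fst_sub, Prod.snd_sub, smul_eq_mul]
    rw [mul_pow, mul_pow, ← mul_add, ← hDP', ← hr2]
    field_simp
  refine ⟨c, r⁻¹ • (P - c), r, hrpos, hunit, ?_, fun p hp => hdisc p (hr2 ▸ hp),
    fun x hx => hn x (subset_closure hx)⟩
  set n := r⁻¹ • (P - c)
  have hrw : r ≤ |w.1| := by
    rw [hr]; exact Real.sqrt_le_iff.2 ⟨abs_nonneg _, by rw [sq_abs]; exact hPS.2⟩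
  have h1 := hn q (subset_closure (interior_subset hq))
  have h2 := hn _ hy₀
  simp only [pair, hc, Prod.fst_sub, Prod.snd_sub] at h1 h2
  have hw1 : |n.1 * w.1 + n.2 * w.2| ≤ r := by
    rw [abs_le]; constructor <;> simp only [hw] <;> linarith
  have hn1 : |n.1| ≤ 1 := by
    rw [← sq_le_one_iff_abs_le_one]; nlinarith [sq_nonneg n.2]
  have h3 : |n.2| * |w.2| ≤ 2 * |w.1| := by
    rw [← abs_mul]
    have e1 : |n.2 * w.2| ≤ |n.1 * w.1 + n.2 * w.2| + |n.1 * w.1| := by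
      have := abs_sub (n.1 * w.1 + n.2 * w.2) (n.1 * w.1)
      rwa [add_sub_cancel_left] at this
    have e2 : |n.1 * w.1| ≤ |w.1| := by
      rw [abs_mul]; exact mul_le_of_le_one_left (abs_nonneg _) hn1
    linarith
  have hw1pos : 0 < |w.1| := abs_pos.2 (by simp only [hw]; exact div_ne_zero hX two_ne_zero)
  have hwC : C * |w.1| < |w.2| := by
    simp only [hw, abs_div]
    have : |(2 : ℝ)| = 2 := by norm_num
    rw [this]; linarith
  rcases (abs_nonneg n.2).eq_or_lt with h0 | h0
  · rw [← h0]; simp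
  · have : (C * |n.2|) * |w.1| < 2 * |w.1| := by nlinarith
    exact lt_of_mul_lt_mul_right this hw1pos.le

lemma exists_mem_closure_leftX {Ω : Set (ℝ × ℝ)} (hb : Bornology.IsBounded Ω)
    (hne : Ω.Nonempty) : ∃ y, (leftX Ω, y) ∈ closure Ω := by
  have hbd : BddBelow (Prod.fst '' Ω) := (hb.image_fst).bddBelow
  have h1 := csInf_mem_closure (hne.image Prod.fst) hbd
  rw [← image_closure_of_isCompact hb.isCompact_closure continuous_fst.continuousOn] at h1
  obtain ⟨p, hp, h⟩ := h1
  exact ⟨p.2, by rw [leftX, ← h]; exact hp⟩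

lemma exists_mem_closure_rightX {Ω : Set (ℝ × ℝ)} (hb : Bornology.IsBounded Ω)
    (hne : Ω.Nonempty) : ∃ y, (rightX Ω, y) ∈ closure Ω := by
  have hbd : BddAbove (Prod.fst '' Ω) := (hb.image_fst).bddAbove
  have h1 := csSup_mem_closure (hne.image Prod.fst) hbd
  rw [← image_closure_of_isCompact hb.isCompact_closure continuous_fst.continuousOn] at h1
  obtain ⟨p, hp, h⟩ := h1
  exact ⟨p.2, by rw [rightX, ← h]; exact hp⟩

lemma exists_horizontal_shift_mem {Ω : Set (ℝ × ℝ)} {q : ℝ × ℝ} (hq : q ∈ interior Ω) :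
    ∃ δ > 0, (q.1 - δ, q.2) ∈ Ω ∧ (q.1 + δ, q.2) ∈ Ω := by
  obtain ⟨ρ, hρ, hball⟩ := Metric.isOpen_iff.1 isOpen_interior q hq
  refine ⟨ρ / 2, by positivity, ?_, ?_⟩ <;> apply interior_subset (hball _) <;>
    rw [Metric.mem_ball, dist_eq_norm, Prod.norm_def] <;>
    simp [abs_of_pos hρ, hρ]

lemma fst_ne_leftX {Ω : Set (ℝ × ℝ)} (hb : Bornology.IsBounded Ω) :
    ∀ q ∈ interior Ω, q.1 ≠ leftX Ω := by
  intro q hq h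
  obtain ⟨δ, hδ, h1, -⟩ := exists_horizontal_shift_mem hq
  have : leftX Ω ≤ q.1 - δ := csInf_le (hb.image_fst).bddBelow ⟨_, h1, rfl⟩
  linarith

lemma fst_ne_rightX {Ω : Set (ℝ × ℝ)} (hb : Bornology.IsBounded Ω) :
    ∀ q ∈ interior Ω, q.1 ≠ rightX Ω := by
  intro q hq h
  obtain ⟨δ, hδ, -, h1⟩ := exists_horizontal_shift_mem hq
  have : q.1 + δ ≤ rightX Ω := le_csSup (hb.image_fst).bddAbove ⟨_, h1, rfl⟩
  linarith

/-- An inscribed disc whose radius through `a` has direction `n` bounds the component of an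
admissible gradient orthogonal to `n` by the square root of the component along `n`. -/
lemma sq_tangential_le {Ω : Set (ℝ × ℝ)} {c n g : ℝ × ℝ} {r η : ℝ} (hn : n.1 ^ 2 + n.2 ^ 2 = 1)
    (hη : 0 < η) (hηr : η < r)
    (hdisc : ∀ q : ℝ × ℝ, (q.1 - c.1) ^ 2 + (q.2 - c.2) ^ 2 < r ^ 2 → q ∈ interior Ω)
    (hg : g ∈ roofGrads Ω (c + (r - η) • n)) :
    r ^ 2 * (g.2 * n.1 - g.1 * n.2) ^ 2 ≤ 1 + 2 * r * |pair g n| := by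
  set N := √(g.1 ^ 2 + g.2 ^ 2) with hN
  have hN0 : 0 ≤ N := Real.sqrt_nonneg _
  have hN2 : N ^ 2 = g.1 ^ 2 + g.2 ^ 2 := Real.sq_sqrt (by positivity)
  have hsplit : N ^ 2 = pair g n ^ 2 + (g.2 * n.1 - g.1 * n.2) ^ 2 := by
    have : pair g n ^ 2 + (g.2 * n.1 - g.1 * n.2) ^ 2
        = (g.1 ^ 2 + g.2 ^ 2) * (n.1 ^ 2 + n.2 ^ 2) := by unfold pair; ring
    rw [this, hn, hN2, mul_one]
  have hr : 0 < r := hη.trans hηr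
  have hα := neg_abs_le (pair g n)
  have hα0 := abs_nonneg (pair g n)
  have key : r * N ≤ 1 + r * |pair g n| := by
    rcases hN0.eq_or_lt with h0 | h0
    · rw [← h0, mul_zero]; positivity
    · rw [← le_div_iff₀ h0]
      refine le_of_forall_lt_imp_le_of_dense fun s hs => ?_
      rcases le_or_gt s 0 with hs0 | hs0
      · exact hs0.trans (show 0 ≤ (1 + r * |pair g n|) / N by positivity)
      rw [le_div_iff₀ h0]
      have hmem : c - (s / N) • g ∈ Ω := by
        apply interior_subset (hdisc _ _)
        have : ((c - (s / N) • g).1 - c.1) ^ 2 + ((c - (s / N) • g).2 - c.2) ^ 2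
            = (s / N) ^ 2 * N ^ 2 := by
          rw [hN2]
          simp only [Prod.fst_sub, Prod.snd_sub, Prod.smul_fst, Prod.smul_snd, smul_eq_mul]
          ring
        rw [this, ← mul_pow, div_mul_cancel₀ _ h0.ne']
        exact pow_lt_pow_left₀ hs hs0.le two_ne_zero
      have h := hg _ hmem
      have hpg : pair g g = N ^ 2 := by rw [hN2]; unfold pair; ring
      have e : s / N * N ^ 2 = s * N := by field_simp
      rw [pair_sub_right, pair_sub_right, pair_add_right, pair_smul_right, pair_smul_right, hpg, e] at h
      nlinarith
  have h2 : (r * N) ^ 2 ≤ (1 + r * |pair g n|) ^ 2 :=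
    pow_le_pow_left₀ (by positivity) key 2
  have h3 : |pair g n| ^ 2 = pair g n ^ 2 := sq_abs _
  nlinarith

/-- A quadratic form that is positive along the first axis grows like `α ^ 2` on the region
`β ^ 2 = O(|α|)`. -/
lemma quadratic_lower_bound {A B D r : ℝ} (hA : 0 < A) (hD : 0 ≤ D) (hr : 0 < r) :
    ∃ C : ℝ, 0 ≤ C ∧ ∀ α β : ℝ, r ^ 2 * β ^ 2 ≤ 1 + 2 * r * |α| →
      A / 2 * α ^ 2 - C ≤ A * α ^ 2 + B * α * β - D * β ^ 2 := by
  set K := B ^ 2 / A + D with hK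
  have hK0 : 0 ≤ K := by positivity
  refine ⟨4 * K ^ 2 / (A * r ^ 2) + K / r ^ 2, by positivity, fun α β h => ?_⟩
  have h1 : -(A / 4 * α ^ 2 + B ^ 2 / A * β ^ 2) ≤ B * α * β := by
    have : 0 ≤ A * (α / 2 + B / A * β) ^ 2 := by positivity
    have e : A * (α / 2 + B / A * β) ^ 2
        = A / 4 * α ^ 2 + B ^ 2 / A * β ^ 2 + B * α * β := by field_simp; ring
    linarith
  have h2 : β ^ 2 ≤ 1 / r ^ 2 + 2 * |α| / r := by
    have : 1 / r ^ 2 + 2 * |α| / r = (1 + 2 * r * |α|) / r ^ 2 := by field_simp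
    rw [this, le_div_iff₀ (by positivity)]; linarith
  have h3 : K * β ^ 2 ≤ K / r ^ 2 + 2 * K * |α| / r :=
    (mul_le_mul_of_nonneg_left h2 hK0).trans_eq (by ring)
  have h4 : 2 * K * |α| / r ≤ A / 4 * α ^ 2 + 4 * K ^ 2 / (A * r ^ 2) := by
    have : 0 ≤ A * (|α| / 2 - 2 * K / (A * r)) ^ 2 := by positivity
    have e : A * (|α| / 2 - 2 * K / (A * r)) ^ 2
        = A / 4 * |α| ^ 2 + 4 * K ^ 2 / (A * r ^ 2) - 2 * K * |α| / r := by field_simp; ring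
    rw [sq_abs] at e
    linarith
  have h5 : K * β ^ 2 = B ^ 2 / A * β ^ 2 + D * β ^ 2 := by rw [hK]; ring
  linarith

/-- The point with depth `v.1` below `c + r • n` and tangential coordinate `v.2`. -/
def discChart (c n : ℝ × ℝ) (r : ℝ) (v : ℝ × ℝ) : ℝ × ℝ :=
  (c.1 + (r - v.1) * n.1 - v.2 * n.2, c.2 + (r - v.1) * n.2 + v.2 * n.1)

lemma continuous_discChart (c n : ℝ × ℝ) (r : ℝ) : Continuous (discChart c n r) := by
  unfold discChart; fun_prop

lemma volume_image_discChart (c : ℝ × ℝ) {n : ℝ × ℝ} (hn : n.1 ^ 2 + n.2 ^ 2 = 1) (r : ℝ)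
    (s : Set (ℝ × ℝ)) : volume (discChart c n r '' s) = volume s := by
  let L : ℝ × ℝ →ₗ[ℝ] ℝ × ℝ :=
    Matrix.toLin (Module.Basis.finTwoProd ℝ) (Module.Basis.finTwoProd ℝ) !![-n.1, -n.2; -n.2, n.1]
  have hL : LinearMap.det L = -1 := by
    rw [LinearMap.det_toLin, Matrix.det_fin_two_of]; linarith
  have h : discChart c n r = (fun x => (c + r • n) + x) ∘ L := by
    funext v
    simp only [Function.comp, L, Matrix.toLin_finTwoProd_apply, discChart]
    ext <;> simp <;> ring
  rw [h, image_comp, image_add_left, measure_preimage_add, Measure.addHaar_image_linearMap, hL]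
  simp

/-- Near the touching point the roof with apex at depth `η` has slope at least `1 / (16 η)` in
the normal direction. -/
lemma normal_slope_lower_bound {η r α β z t : ℝ} (hη : 0 < η) (hηr : η ≤ r)
    (hβ : r ^ 2 * β ^ 2 ≤ 1 + 2 * r * |α|) (hz : 0 ≤ z) (hz' : z ≤ η / 2)
    (ht : t ^ 2 ≤ r * η / 64) (h : 1 + ((η - z) * α + t * β) ≤ z / η) :
    1 / (256 * η ^ 2) ≤ α ^ 2 := by
  have hr : 0 < r := hη.trans_le hηr
  have hzη : z / η ≤ 1 / 2 := by rw [div_le_iff₀ hη]; linarith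
  have hα : 1 / 16 ≤ |α| * η := by
    by_contra! hlt
    have h1 : -(η * |α|) ≤ (η - z) * α := by
      nlinarith [neg_abs_le α, abs_nonneg α]
    have h2 : t * β ≤ -(7 / 16) := by linarith
    have h3 : (7 / 16) ^ 2 ≤ (t * β) ^ 2 := by nlinarith
    have h4 : r ^ 2 * (t * β) ^ 2 ≤ r * η / 64 * (1 + 2 * r * |α|) := by
      calc r ^ 2 * (t * β) ^ 2 = t ^ 2 * (r ^ 2 * β ^ 2) := by ring
        _ ≤ _ := mul_le_mul ht hβ (by positivity) (by positivity)
    have h5 : r * η / 64 * (1 + 2 * r * |α|) ≤ r ^ 2 * (9 / 8 / 64) := by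
      have : r * η / 64 * (1 + 2 * r * |α|) = r * η / 64 + r ^ 2 * (|α| * η) / 32 := by ring
      nlinarith
    nlinarith [mul_le_mul_of_nonneg_left h3 (sq_nonneg r), pow_pos hr 2]
  have : (1 / 16) ^ 2 ≤ (|α| * η) ^ 2 := pow_le_pow_left₀ (by norm_num) hα 2
  rw [mul_pow, sq_abs] at this
  rw [div_le_iff₀ (by positivity)]
  linarith

/-- If `Ω` has an inscribed disc touching its boundary at a point where the normal `n` satisfies
`n.1 ^ 2 > M * n.2 ^ 2`, then roofs whose apex is close to that point satisfy
`M * Iy Ω u < Ix Ω u`. -/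
lemma exists_roof_of_touching_disc {Ω : Set (ℝ × ℝ)}
    (hb : Bornology.IsBounded Ω) {c n : ℝ × ℝ} {r M : ℝ} (hM : 0 ≤ M) (hr : 0 < r)
    (hn : n.1 ^ 2 + n.2 ^ 2 = 1) (hA : 0 < n.1 ^ 2 - M * n.2 ^ 2)
    (hdisc : ∀ q : ℝ × ℝ, (q.1 - c.1) ^ 2 + (q.2 - c.2) ^ 2 < r ^ 2 → q ∈ interior Ω)
    (hsupp : ∀ q ∈ Ω, pair n (q - c) ≤ r) :
    ∃ a ∈ interior Ω, M * Iy Ω (roof Ω a) < Ix Ω (roof Ω a) := by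
  set A := n.1 ^ 2 - M * n.2 ^ 2 with hAdef
  obtain ⟨C, hC0, hC⟩ := quadratic_lower_bound (A := A) (B := -(2 * (1 + M) * n.1 * n.2))
    (D := M * n.1 ^ 2) hA (by positivity) hr
  have hvol : volume Ω ≠ ⊤ := hb.measure_lt_top.ne
  set V := volume.real Ω with hV
  have hV0 : 0 ≤ V := measureReal_nonneg
  -- `ε` is the square root of the relative depth of the apex
  obtain ⟨ε, hε0, hε1, hε⟩ : ∃ ε : ℝ, 0 < ε ∧ ε < 1 ∧ C * V < A / (8192 * ε) := by
    refine ⟨min (1 / 2) (A / (8192 * (C * V + 1))), by positivity,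
      (min_le_left _ _).trans_lt (by norm_num), ?_⟩
    have h1 := min_le_right (1 / 2) (A / (8192 * (C * V + 1)))
    have h0 : 0 < min (1 / 2) (A / (8192 * (C * V + 1))) := by positivity
    rw [le_div_iff₀ (by positivity)] at h1
    rw [lt_div_iff₀ (by positivity)]
    nlinarith
  set η := r * ε ^ 2 with hη
  have hη0 : 0 < η := by positivity
  have hηr : η < r := by
    have : ε ^ 2 < 1 := pow_lt_one₀ hε0.le hε1 two_ne_zero
    rw [hη]; nlinarith
  set a := c + (r - η) • n with ha
  have haint : a ∈ interior Ω := by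
    apply hdisc
    have : (a.1 - c.1) ^ 2 + (a.2 - c.2) ^ 2 = (r - η) ^ 2 * (n.1 ^ 2 + n.2 ^ 2) := by
      simp only [ha, Prod.fst_add, Prod.snd_add, Prod.smul_fst, Prod.smul_snd, smul_eq_mul]
      ring
    rw [this, hn]; nlinarith
  refine ⟨a, haint, ?_⟩
  set u := roof Ω a with hu
  obtain ⟨K, hK⟩ := exists_lipschitzWith_roof haint
  have hpair_n : pair n n = 1 := by rw [← hn]; unfold pair; ring
  have hg₀ : (-η⁻¹) • n ∈ roofGrads Ω a := by
    intro x hx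
    have h1 := hsupp x hx
    have h2 : pair ((-η⁻¹) • n) (x - a) = -η⁻¹ * (pair n (x - c) - (r - η)) := by
      have : pair n (x - a) = pair n (x - c) - (r - η) := by
        rw [ha, pair_sub_right, pair_sub_right, pair_add_right, pair_smul_right, hpair_n]; ring
      rw [← this]
      simp only [pair, Prod.smul_fst, Prod.smul_snd, smul_eq_mul]; ring
    have h3 : 1 + -η⁻¹ * (pair n (x - c) - (r - η)) = η⁻¹ * (r - pair n (x - c)) := by
      field_simp; ring
    rw [h2, h3]
    exact mul_nonneg (by positivity) (sub_nonneg.2 h1)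
  let R : Set (ℝ × ℝ) := Icc (η / 4) (η / 2) ×ˢ Icc (-(r * ε / 8)) (r * ε / 8)
  have hRc : IsCompact R := isCompact_Icc.prod isCompact_Icc
  let E := discChart c n r '' R
  have hEm : MeasurableSet E := (hRc.image (continuous_discChart c n r)).measurableSet
  have ht : ∀ v ∈ R, v.2 ^ 2 ≤ r * η / 64 := by
    intro v hv
    have : |v.2| ≤ r * ε / 8 := abs_le.2 hv.2
    have := pow_le_pow_left₀ (abs_nonneg _) this 2
    rw [sq_abs] at this
    calc _ ≤ _ := this
      _ = _ := by rw [hη]; ring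
  have hEΩ : E ⊆ Ω := by
    rintro _ ⟨v, hv, rfl⟩
    apply interior_subset (hdisc _ _)
    have e : ((discChart c n r v).1 - c.1) ^ 2 + ((discChart c n r v).2 - c.2) ^ 2
        = ((r - v.1) ^ 2 + v.2 ^ 2) * (n.1 ^ 2 + n.2 ^ 2) := by simp only [discChart]; ring
    rw [e, hn]
    have := ht v hv
    have h1 : η / 4 ≤ v.1 := hv.1.1
    have h2 : v.1 ≤ η / 2 := hv.1.2
    nlinarith
  have hEvol : volume.real E = η * r * ε / 16 := by
    have h1 : volume E = ENNReal.ofReal (η / 4) * ENNReal.ofReal (r * ε / 4) := by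
      rw [show volume E = volume R from volume_image_discChart c hn r R, Measure.volume_eq_prod,
        Measure.prod_prod, Real.volume_Icc, Real.volume_Icc]
      congr 2 <;> ring
    rw [measureReal_def, h1, ENNReal.toReal_mul, ENNReal.toReal_ofReal (by positivity),
      ENNReal.toReal_ofReal (by positivity)]
    ring
  have hpoint : ∀ᵐ p ∂(volume.restrict Ω),
      E.indicator (fun _ => A / 2 * (1 / (256 * η ^ 2))) p - C ≤ uX u p ^ 2 - M * uY u p ^ 2 := by
    filter_upwards [ae_restrict_of_ae hK.ae_differentiableAt] with p hp
    obtain ⟨g, hg, hgp, hgx, hgy⟩ := exists_roof_gradient haint hp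
    have htan := sq_tangential_le hn hη0 hηr hdisc hg
    have hq := hC (pair g n) (g.2 * n.1 - g.1 * n.2) htan
    have e : A * pair g n ^ 2 + -(2 * (1 + M) * n.1 * n.2) * pair g n * (g.2 * n.1 - g.1 * n.2)
        - M * n.1 ^ 2 * (g.2 * n.1 - g.1 * n.2) ^ 2
        ≤ g.1 ^ 2 - M * g.2 ^ 2 := by
      have e1 : g.1 = pair g n * n.1 - (g.2 * n.1 - g.1 * n.2) * n.2 := by
        unfold pair; linear_combination (-g.1) * hn
      have e2 : g.2 = pair g n * n.2 + (g.2 * n.1 - g.1 * n.2) * n.1 := by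
        unfold pair; linear_combination (-g.2) * hn
      generalize pair g n = α at *
      generalize g.2 * n.1 - g.1 * n.2 = β at *
      rw [e1, e2, hAdef]
      nlinarith [sq_nonneg (β * n.2)]
    rw [hu, hgx, hgy]
    refine le_trans ?_ (hq.trans e)
    refine sub_le_sub_right ?_ C
    by_cases hpE : p ∈ E
    · rw [indicator_of_mem hpE]
      refine mul_le_mul_of_nonneg_left ?_ (by positivity)
      obtain ⟨v, hv, rfl⟩ := hpE
      refine normal_slope_lower_bound (z := v.1) (t := v.2) hη0 hηr.le htan
        (le_trans (by positivity) hv.1.1) hv.1.2 (ht v hv) ?_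
      have h1 := roof_le haint hg₀ (discChart c n r v)
      rw [hgp] at h1
      have h2 : pair g (discChart c n r v - a)
          = (η - v.1) * pair g n + v.2 * (g.2 * n.1 - g.1 * n.2) := by
        simp only [pair, discChart, ha, Prod.fst_sub, Prod.snd_sub, Prod.fst_add, Prod.snd_add,
          Prod.smul_fst, Prod.smul_snd, smul_eq_mul]
        ring
      have h3 : 1 + pair ((-η⁻¹) • n) (discChart c n r v - a) = v.1 / η := by
        have : pair ((-η⁻¹) • n) (discChart c n r v - a)
            = -η⁻¹ * ((η - v.1) * (n.1 ^ 2 + n.2 ^ 2)) := by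
          simp only [pair, discChart, ha, Prod.fst_sub, Prod.snd_sub, Prod.fst_add, Prod.snd_add,
            Prod.smul_fst, Prod.smul_snd, smul_eq_mul]
          ring
        rw [this, hn]
        field_simp
        ring
      rwa [h2, h3] at h1
    · rw [indicator_of_notMem hpE]; positivity
  have hint_sq : ∀ w : ℝ × ℝ, Integrable (fun p => (fderiv ℝ u p w) ^ 2) (volume.restrict Ω) := by
    intro w
    refine Measure.integrableOn_of_bounded (M := (K * ‖w‖) ^ 2) hvol
      ((measurable_fderiv_apply_const ℝ u w).pow_const 2).aestronglyMeasurable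
      (Eventually.of_forall fun p => ?_)
    rw [norm_pow]
    refine pow_le_pow_left₀ (norm_nonneg _) ?_ 2
    exact (ContinuousLinearMap.le_opNorm _ _).trans
      (mul_le_mul_of_nonneg_right (norm_fderiv_le_of_lipschitz ℝ hK) (norm_nonneg _))
  have hX : Integrable (fun p => uX u p ^ 2) (volume.restrict Ω) := hint_sq (1, 0)
  have hY : Integrable (fun p => uY u p ^ 2) (volume.restrict Ω) := hint_sq (0, 1)
  have hfin : IsFiniteMeasure (volume.restrict Ω) := ⟨by
    rw [Measure.restrict_apply_univ]; exact hvol.lt_top⟩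
  have hI : Integrable (E.indicator fun _ => A / 2 * (1 / (256 * η ^ 2))) (volume.restrict Ω) :=
    (integrable_const _).indicator hEm
  have hmono := integral_mono_ae (hI.sub (integrable_const C)) (hX.sub (hY.const_mul M)) hpoint
  simp only [Pi.sub_apply] at hmono
  rw [integral_sub hI (integrable_const C), integral_sub hX (hY.const_mul M),
    integral_const_mul, integral_indicator hEm, Measure.restrict_restrict hEm,
    inter_eq_self_of_subset_left hEΩ, setIntegral_const, setIntegral_const, hEvol, smul_eq_mul,
    smul_eq_mul] at hmono
  have hval : η * r * ε / 16 * (A / 2 * (1 / (256 * η ^ 2))) = A / (8192 * ε) := by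
    rw [hη]; field_simp; norm_num
  rw [hval] at hmono
  change M * (∫ p in Ω, uY u p ^ 2) < ∫ p in Ω, uX u p ^ 2
  linarith [mul_comm V C]

/-- If at least one vertical support line of `Ω` is not angular, then the supremum of
`(∫_Ω u_x²)/(∫_Ω u_y²)` over nonzero `u ∈ U_Ω` is `+∞`. -/
theorem stmt0 (Ω : Set (ℝ × ℝ)) (hconv : Convex ℝ Ω) (hbdd : Bornology.IsBounded Ω)
    (hint : (interior Ω).Nonempty)
    (hang : ¬ AngularSupportAt Ω (leftX Ω) ∨ ¬ AngularSupportAt Ω (rightX Ω)) :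
    ∀ M : ℝ, ∃ u : ℝ × ℝ → ℝ, MemU Ω u ∧ (∃ p ∈ Ω, u p ≠ 0) ∧ M * Iy Ω u < Ix Ω u := by
  intro M
  obtain ⟨x₀, y₀, hx₀, hy₀, hx₀ang⟩ : ∃ x₀ y₀, (∀ q ∈ interior Ω, q.1 ≠ x₀) ∧
      (x₀, y₀) ∈ closure Ω ∧ ¬ AngularSupportAt Ω x₀ := by
    have hne : Ω.Nonempty := hint.mono interior_subset
    rcases hang with h | h
    · obtain ⟨y, hy⟩ := exists_mem_closure_leftX hbdd hne
      exact ⟨_, y, fst_ne_leftX hbdd, hy, h⟩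
    · obtain ⟨y, hy⟩ := exists_mem_closure_rightX hbdd hne
      exact ⟨_, y, fst_ne_rightX hbdd, hy, h⟩
  set m := max M 0 with hm
  have hm0 : 0 ≤ m := le_max_right _ _
  obtain ⟨c, n, r, hr, hn, hn2, hdisc, hsupp⟩ :=
    exists_touching_disc hconv hint hx₀ hy₀ hx₀ang (C := 2 * (m + 1)) (by positivity)
  have hA : 0 < n.1 ^ 2 - m * n.2 ^ 2 := by
    have h1 : (m + 1) * |n.2| < 1 := by linarith
    have h2 := abs_nonneg n.2
    have h3 : |n.2| < 1 := by nlinarith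
    have h4 : |n.2| ^ 2 = n.2 ^ 2 := sq_abs _
    nlinarith
  obtain ⟨a, ha, hlt⟩ := exists_roof_of_touching_disc hbdd hm0 hr hn hA hdisc hsupp
  refine ⟨roof Ω a, memU_roof ha hconv, ⟨a, interior_subset ha, ?_⟩, lt_of_le_of_lt ?_ hlt⟩
  · rw [roof_apex ha]; exact one_ne_zero
  · exact mul_le_mul_of_nonneg_right (le_max_left _ _)
      (integral_nonneg fun p => sq_nonneg _)
end

section
/- Let Ω ⊂ ℝ² be a convex bounded set with nonempty interior such that both of its vertical support lines (lines parallel to the y-axis) are angular. Then the supremum, over all nonzero functions u in U_Ω, of the ratio (∫_Ω u_x² dx dy)/(∫_Ω u_y² dx dy) is finite, i.e., there exists a real constant K > 0 such that ∫_Ω u_x² dx dy ≤ K ∫_Ω u_y² dx dy for all u ∈ U_Ω. -/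
open MeasureTheory Real Set Filter Asymptotics

open Topology

/-- A concave function lies below its tangent planes. -/
lemma ConcaveOn.le_add_fderiv {E : Type*} [NormedAddCommGroup E] [NormedSpace ℝ E]
    {S : Set E} {u : E → ℝ} (hu : ConcaveOn ℝ S u) {p q : E} (hp : p ∈ S) (hq : q ∈ S)
    (hd : DifferentiableAt ℝ u p) : u q ≤ u p + fderiv ℝ u p (q - p) := by
  have hc := hu.comp_affineMap (AffineMap.lineMap p q : ℝ →ᵃ[ℝ] E)
  have h1 : HasDerivAt (u ∘ (AffineMap.lineMap p q : ℝ →ᵃ[ℝ] E)) (fderiv ℝ u p (q - p)) 0 := by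
    have h2 : HasFDerivAt u (fderiv ℝ u p) ((AffineMap.lineMap p q : ℝ →ᵃ[ℝ] E) 0) := by
      simpa using hd.hasFDerivAt
    exact h2.comp_hasDerivAt 0 AffineMap.hasDerivAt_lineMap
  have h3 := hc.slope_le_of_hasDerivAt (x := 0) (y := 1) (by simpa using hp) (by simpa using hq)
    one_pos h1
  simp only [slope_def_field, Function.comp_apply, AffineMap.lineMap_apply_one,
    AffineMap.lineMap_apply_zero, sub_zero, div_one] at h3
  linarith

/-- The tangent plane inequality for concave functions, extended to the closure. -/
lemma ConcaveOn.le_add_fderiv_of_mem_closure {E : Type*} [NormedAddCommGroup E] [NormedSpace ℝ E]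
    {S : Set E} {u : E → ℝ} (hu : ConcaveOn ℝ S u) (hcont : ContinuousOn u (closure S))
    {p q : E} (hp : p ∈ S) (hq : q ∈ closure S)
    (hd : DifferentiableAt ℝ u p) : u q ≤ u p + fderiv ℝ u p (q - p) := by
  have : (𝓝[S] q).NeBot := mem_closure_iff_nhdsWithin_neBot.mp hq
  have h1 : Tendsto u (𝓝[S] q) (𝓝 (u q)) := (hcont q hq).mono subset_closure
  have h2 : Tendsto (fun r => u p + fderiv ℝ u p (r - p)) (𝓝[S] q)
      (𝓝 (u p + fderiv ℝ u p (q - p))) :=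
    Tendsto.mono_left (Continuous.tendsto (by fun_prop) q) nhdsWithin_le_nhds
  refine le_of_tendsto_of_tendsto h1 h2 ?_
  filter_upwards [self_mem_nhdsWithin] with r hr using hu.le_add_fderiv hp hr hd

lemma abs_fderiv_apply_le {E : Type*} [NormedAddCommGroup E] [NormedSpace ℝ E]
    (u : E → ℝ) (p : E) {v : E} (hv : ‖v‖ ≤ 1) : |fderiv ℝ u p v| ≤ ‖fderiv ℝ u p‖ :=
  ((fderiv ℝ u p).le_opNorm v).trans (mul_le_of_le_one_right (norm_nonneg _) hv)

lemma sq_integral_le_measureReal_mul {α : Type*} [MeasurableSpace α] {μ : Measure α}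
    [IsFiniteMeasure μ] {f : α → ℝ} (hf : Integrable f μ) (hf2 : Integrable (fun x => f x ^ 2) μ) :
    (∫ x, f x ∂μ) ^ 2 ≤ μ.real univ * ∫ x, f x ^ 2 ∂μ := by
  rcases eq_zero_or_neZero μ with rfl | hμ
  · simp
  set m := μ.real univ with hm
  have hmpos : 0 < m := measureReal_univ_pos
  set J := ∫ x, f x ∂μ with hJ
  have h0 : 0 ≤ ∫ x, (m * f x - J) ^ 2 ∂μ := integral_nonneg fun x => sq_nonneg _
  have h1 : ∫ x, (m * f x - J) ^ 2 ∂μ = m ^ 2 * ∫ x, f x ^ 2 ∂μ - 2 * m * J * J + m * J ^ 2 := by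
    have : ∀ x, (m * f x - J) ^ 2 = m ^ 2 * f x ^ 2 - 2 * m * J * f x + J ^ 2 := fun x => by ring
    simp_rw [this]
    rw [integral_add (by fun_prop) (by fun_prop), integral_sub (by fun_prop) (by fun_prop),
      integral_const_mul, integral_const_mul, integral_const, smul_eq_mul]
  rw [h1] at h0
  have h2 : 0 ≤ m * (m * ∫ x, f x ^ 2 ∂μ - J ^ 2) := by linarith
  have := nonneg_of_mul_nonneg_right h2 hmpos
  linarith

/-- One-dimensional Poincaré inequality for concave functions vanishing at the left endpoint. -/
lemma ConcaveOn.setIntegral_sq_le {a b : ℝ} {g h : ℝ → ℝ} (hab : a < b)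
    (hg : ConcaveOn ℝ (Ioo a b) g) (hcont : ContinuousOn g (Icc a b)) (ha : g a = 0)
    (hd : ∀ᵐ y ∂(volume.restrict (Ioo a b)), HasDerivAt g (h y) y)
    (hi : IntegrableOn h (Ioo a b)) (hi2 : IntegrableOn (fun y => h y ^ 2) (Ioo a b)) :
    ∫ y in Ioo a b, g y ^ 2 ≤ (b - a) ^ 2 * ∫ y in Ioo a b, h y ^ 2 := by
  set I := ∫ y in Ioo a b, h y ^ 2
  have hright : ∀ y ∈ Ioo a b, HasDerivWithinAt g (derivWithin g (Ioi y) y) (Ioi y) y := by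
    intro y hy
    have := hg.neg.hasDerivWithinAt_rightDeriv_of_mem_interior (x := y) (by simpa using hy)
    have h2 := this.neg.differentiableWithinAt
    simp only [neg_neg] at h2
    exact h2.hasDerivWithinAt
  have hae : (fun y => derivWithin g (Ioi y) y) =ᵐ[volume.restrict (Ioo a b)] h := by
    filter_upwards [hd] with y hy
    exact hy.hasDerivWithinAt.derivWithin (uniqueDiffWithinAt_Ioi y)
  have key : ∀ y ∈ Ioo a b, g y ^ 2 ≤ (b - a) * I := by
    intro y hy
    have hsub : Ioo a y ⊆ Ioo a b := Ioo_subset_Ioo_right hy.2.le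
    have hae' : (fun y => derivWithin g (Ioi y) y) =ᵐ[volume.restrict (Ioo a y)] h :=
      ae_restrict_of_ae_restrict_of_subset hsub hae
    have hint : IntegrableOn (fun y => derivWithin g (Ioi y) y) (Ioo a y) :=
      (hi.mono_set hsub).congr hae'.symm
    have h1 := intervalIntegral.integral_eq_sub_of_hasDeriv_right_of_le hy.1.le
      (hcont.mono (Icc_subset_Icc_right hy.2.le)) (fun z hz => hright z (hsub hz))
      ((intervalIntegrable_iff_integrableOn_Ioo_of_le hy.1.le).2 hint)
    rw [intervalIntegral.integral_of_le hy.1.le, integral_Ioc_eq_integral_Ioo,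
      integral_congr_ae hae', ha, sub_zero] at h1
    rw [← h1]
    have h2 := sq_integral_le_measureReal_mul (μ := volume.restrict (Ioo a y)) (hi.mono_set hsub)
      (hi2.mono_set hsub)
    have h3 : (volume.restrict (Ioo a y)).real univ = y - a := by
      simp [measureReal_def, hy.1.le]
    rw [h3] at h2
    refine h2.trans ?_
    have h4 : ∫ z in Ioo a y, h z ^ 2 ≤ I :=
      setIntegral_mono_set hi2 (ae_of_all _ fun z => sq_nonneg _) hsub.eventuallyLE
    exact mul_le_mul (by linarith [hy.2]) h4 (integral_nonneg fun z => sq_nonneg _)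
      (by linarith)
  have hgi : IntegrableOn (fun y => g y ^ 2) (Ioo a b) :=
    ((hcont.pow 2).integrableOn_compact isCompact_Icc).mono_set Ioo_subset_Icc_self
  calc ∫ y in Ioo a b, g y ^ 2 ≤ ∫ _ in Ioo a b, (b - a) * I :=
        setIntegral_mono_on hgi (integrableOn_const (by simp)) measurableSet_Ioo key
    _ = (b - a) ^ 2 * I := by
        simp [measureReal_def, hab.le]; ring

lemma IsOpen.sInf_lt_of_subset {s t : Set ℝ} (ho : IsOpen s) (hst : s ⊆ t) (hb : BddBelow t)
    {x : ℝ} (hx : x ∈ s) : sInf t < x := by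
  obtain ⟨y, hy, hyx⟩ := (Filter.Eventually.and
    (show ∀ᶠ y in 𝓝[<] x, y ∈ s from mem_nhdsWithin_of_mem_nhds (ho.mem_nhds hx))
    self_mem_nhdsWithin).exists
  exact (csInf_le hb (hst hy)).trans_lt hyx

lemma IsOpen.lt_sSup_of_subset {s t : Set ℝ} (ho : IsOpen s) (hst : s ⊆ t) (hb : BddAbove t)
    {x : ℝ} (hx : x ∈ s) : x < sSup t := by
  obtain ⟨y, hy, hyx⟩ := (Filter.Eventually.and
    (show ∀ᶠ y in 𝓝[>] x, y ∈ s from mem_nhdsWithin_of_mem_nhds (ho.mem_nhds hx))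
    self_mem_nhdsWithin).exists
  exact lt_of_lt_of_le hyx (le_csSup hb (hst hy))

lemma exists_eq_Ioo_of_isOpen {s : Set ℝ} (ho : IsOpen s) (hc : Convex ℝ s) (hne : s.Nonempty)
    (hb : Bornology.IsBounded s) : ∃ a b, a < b ∧ s = Ioo a b := by
  have hs : s = Ioo (sInf s) (sSup s) := Subset.antisymm
    (fun x hx => ⟨ho.sInf_lt_of_subset subset_rfl hb.bddBelow hx,
      ho.lt_sSup_of_subset subset_rfl hb.bddAbove hx⟩)
    (IsConnected.Ioo_csInf_csSup_subset ⟨hne, hc.isPreconnected⟩ hb.bddBelow hb.bddAbove)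
  refine ⟨sInf s, sSup s, ?_, hs⟩
  obtain ⟨x, hx⟩ := hne
  exact (ho.sInf_lt_of_subset subset_rfl hb.bddBelow hx).trans
    (ho.lt_sSup_of_subset subset_rfl hb.bddAbove hx)

lemma leftX_lt_of_mem_interior {Ω : Set (ℝ × ℝ)} (hbdd : Bornology.IsBounded Ω) {p : ℝ × ℝ}
    (hp : p ∈ interior Ω) : leftX Ω < p.1 :=
  (isOpenMap_fst _ isOpen_interior).sInf_lt_of_subset (image_mono interior_subset)
    hbdd.image_fst.bddBelow (mem_image_of_mem _ hp)

lemma lt_rightX_of_mem_interior {Ω : Set (ℝ × ℝ)} (hbdd : Bornology.IsBounded Ω) {p : ℝ × ℝ}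
    (hp : p ∈ interior Ω) : p.1 < rightX Ω :=
  (isOpenMap_fst _ isOpen_interior).lt_sSup_of_subset (image_mono interior_subset)
    hbdd.image_fst.bddAbove (mem_image_of_mem _ hp)

/-- The tangent plane inequality at a boundary point `v` on an angular support line. -/
lemma MemU.mul_uX_le {Ω : Set (ℝ × ℝ)} {u : ℝ × ℝ → ℝ} (hu : MemU Ω u) {p v : ℝ × ℝ} {C : ℝ}
    (hp : p ∈ interior Ω) (hv : v ∈ frontier Ω) (hd : DifferentiableAt ℝ u p)
    (hC : |p.2 - v.2| ≤ C * |p.1 - v.1|) :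
    (p.1 - v.1) * uX u p ≤ |u p| + C * |p.1 - v.1| * |uY u p| := by
  have h1 := hu.2.1.le_add_fderiv_of_mem_closure hu.1 (interior_subset hp)
    (frontier_subset_closure hv) hd
  have h2 : fderiv ℝ u p (v - p) = (v.1 - p.1) * uX u p + (v.2 - p.2) * uY u p := by
    have : v - p = (v.1 - p.1) • ((1, 0) : ℝ × ℝ) + (v.2 - p.2) • ((0, 1) : ℝ × ℝ) := by
      ext <;> simp
    rw [this, map_add, map_smul, map_smul]
    rfl
  rw [hu.2.2.2.2 v hv, h2] at h1
  have h3 : (v.2 - p.2) * uY u p ≤ C * |p.1 - v.1| * |uY u p| := by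
    refine (le_abs_self _).trans ?_
    rw [abs_mul, abs_sub_comm]
    exact mul_le_mul_of_nonneg_right hC (abs_nonneg _)
  linarith [le_abs_self (u p)]

lemma MemU.uX_sq_le {Ω : Set (ℝ × ℝ)} {u : ℝ × ℝ → ℝ} (hu : MemU Ω u) {p l r : ℝ × ℝ} {C D : ℝ}
    (hp : p ∈ interior Ω) (hl : l ∈ frontier Ω) (hr : r ∈ frontier Ω)
    (hlp : l.1 < p.1) (hpr : p.1 < r.1) (hd : DifferentiableAt ℝ u p)
    (hC : |p.2 - l.2| ≤ C * |p.1 - l.1|) (hD : |p.2 - r.2| ≤ D * |p.1 - r.1|) :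
    uX u p ^ 2 ≤ (2 / (p.1 - l.1) ^ 2 + 2 / (r.1 - p.1) ^ 2) * u p ^ 2
      + (2 * C ^ 2 + 2 * D ^ 2) * uY u p ^ 2 := by
  have h1 := hu.mul_uX_le hp hl hd hC
  have h2 := hu.mul_uX_le hp hr hd hD
  have hX : 0 < p.1 - l.1 := by linarith
  have hY : 0 < r.1 - p.1 := by linarith
  rw [abs_of_pos hX] at h1
  rw [abs_sub_comm p.1, abs_of_pos hY] at h2
  set X := p.1 - l.1
  set Y := r.1 - p.1 with hYdef
  have h2' : Y * (-uX u p) ≤ |u p| + D * Y * |uY u p| := by rw [hYdef] at *; linarith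
  have h3 : uX u p ≤ |u p| / X + C * |uY u p| := by
    rw [← mul_le_mul_iff_right₀ hX]
    rw [show X * (|u p| / X + C * |uY u p|) = |u p| + C * X * |uY u p| by field_simp]
    exact h1
  have h4 : -uX u p ≤ |u p| / Y + D * |uY u p| := by
    rw [← mul_le_mul_iff_right₀ hY]
    rw [show Y * (|u p| / Y + D * |uY u p|) = |u p| + D * Y * |uY u p| by field_simp]
    exact h2'
  have e1 : 2 / X ^ 2 * u p ^ 2 = 2 * (|u p| / X) ^ 2 := by
    rw [div_pow, sq_abs]; ring
  have e2 : 2 / Y ^ 2 * u p ^ 2 = 2 * (|u p| / Y) ^ 2 := by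
    rw [div_pow, sq_abs]; ring
  rw [add_mul, e1, e2, ← sq_abs (uY u p)]
  generalize |u p| / X = s at *
  generalize |u p| / Y = t at *
  generalize |uY u p| = v at *
  generalize uX u p = w at *
  rcases le_total 0 w with hw | hw
  · have : w ^ 2 ≤ (s + C * v) ^ 2 := pow_le_pow_left₀ hw h3 2
    nlinarith [sq_nonneg (s - C * v), sq_nonneg t, sq_nonneg (D * v)]
  · have : (-w) ^ 2 ≤ (t + D * v) ^ 2 := pow_le_pow_left₀ (by linarith) h4 2
    nlinarith [sq_nonneg (t - D * v), sq_nonneg s, sq_nonneg (C * v)]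

lemma sub_le_two_mul_of_forall_abs_sub_le {a b c M : ℝ} (hab : a < b)
    (h : ∀ y ∈ Ioo a b, |y - c| ≤ M) : b - a ≤ 2 * M := by
  have h1 : closure (Ioo a b) ⊆ Icc (c - M) (c + M) := closure_minimal
    (fun y hy => by have := abs_le.1 (h y hy); constructor <;> linarith) isClosed_Icc
  rw [closure_Ioo hab.ne] at h1
  have h2 := (h1 (left_mem_Icc.2 hab.le)).1
  have h3 := (h1 (right_mem_Icc.2 hab.le)).2
  linarith

/-- The claimed inequality on a single vertical slice. -/
lemma MemU.setIntegral_slice_le {Ω : Set (ℝ × ℝ)} {u : ℝ × ℝ → ℝ} (hconv : Convex ℝ Ω)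
    (hbdd : Bornology.IsBounded Ω) (hu : MemU Ω u)
    {l r : ℝ × ℝ} {C D : ℝ} (hl : l ∈ frontier Ω) (hr : r ∈ frontier Ω)
    (hlp : ∀ p ∈ interior Ω, l.1 < p.1) (hpr : ∀ p ∈ interior Ω, p.1 < r.1)
    (hC : ∀ p ∈ interior Ω, |p.2 - l.2| ≤ C * |p.1 - l.1|)
    (hD : ∀ p ∈ interior Ω, |p.2 - r.2| ≤ D * |p.1 - r.1|) {x : ℝ}
    (hd : ∀ᵐ y, (x, y) ∈ interior Ω → DifferentiableAt ℝ u (x, y)) :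
    ∫ y in Prod.mk x ⁻¹' interior Ω, uX u (x, y) ^ 2
      ≤ 10 * (C ^ 2 + D ^ 2) * ∫ y in Prod.mk x ⁻¹' interior Ω, uY u (x, y) ^ 2 := by
  set S := Prod.mk x ⁻¹' interior Ω with hS
  rcases S.eq_empty_or_nonempty with hSe | hSne
  · simp [hSe]
  have hSo : IsOpen S := isOpen_interior.preimage (by fun_prop)
  have hSc : Convex ℝ S := by
    intro y hy z hz s t hs ht hst
    have := hconv.interior hy hz hs ht hst
    have e : s • (x, y) + t • (x, z) = (x, s • y + t • z) := by
      ext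
      · simp [← add_mul, hst]
      · simp
    rwa [e] at this
  have hSb : Bornology.IsBounded S := by
    refine hbdd.image_snd.subset fun y hy => ⟨(x, y), interior_subset hy, rfl⟩
  obtain ⟨a, b, hab, hSab⟩ := exists_eq_Ioo_of_isOpen hSo hSc hSne hSb
  have hmem : ∀ y ∈ Ioo a b, (x, y) ∈ interior Ω := fun y hy => by
    rw [← hSab] at hy; exact hy
  have hcl : ∀ y ∈ Icc a b, (x, y) ∈ closure Ω := by
    intro y hy
    rw [← closure_Ioo hab.ne] at hy
    exact map_mem_closure (f := Prod.mk x) (by fun_prop) hy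
      fun z hz => interior_subset (hmem z hz)
  have hua : u (x, a) = 0 := by
    refine hu.2.2.2.2 _ ⟨hcl a (left_mem_Icc.2 hab.le), fun h => ?_⟩
    have : a ∈ S := h
    rw [hSab] at this
    exact this.1.false
  have hcont : ContinuousOn (fun y => u (x, y)) (Icc a b) :=
    hu.1.comp (by fun_prop) hcl
  have hconc : ConcaveOn ℝ (Ioo a b) (fun y => u (x, y)) := by
    refine ⟨convex_Ioo a b, fun y hy z hz s t hs ht hst => ?_⟩
    have := hu.2.1.2 (interior_subset (hmem y hy)) (interior_subset (hmem z hz)) hs ht hst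
    have e : s • (x, y) + t • (x, z) = (x, s • y + t • z) := by
      ext
      · simp [← add_mul, hst]
      · simp
    rwa [e] at this
  have hdiff : ∀ᵐ y ∂(volume.restrict (Ioo a b)), DifferentiableAt ℝ u (x, y) := by
    rw [ae_restrict_iff' measurableSet_Ioo]
    filter_upwards [hd] with y hy hyab using hy (hmem y hyab)
  have hderiv : ∀ᵐ y ∂(volume.restrict (Ioo a b)),
      HasDerivAt (fun y => u (x, y)) (uY u (x, y)) y := by
    filter_upwards [hdiff] with y hy
    exact hy.hasFDerivAt.comp_hasDerivAt y ((hasDerivAt_const y x).prodMk (hasDerivAt_id y))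
  obtain ⟨B, hB⟩ := hu.2.2.2.1
  have hbound : ∀ᵐ y ∂(volume.restrict (Ioo a b)), |uY u (x, y)| ≤ B := by
    filter_upwards [hdiff, ae_restrict_mem measurableSet_Ioo] with y hy hyab
    exact (abs_fderiv_apply_le u _ (by simp)).trans (hB _ (interior_subset (hmem y hyab)) hy)
  have hmeas : Measurable fun y => uY u (x, y) :=
    (measurable_fderiv_apply_const ℝ u _).comp measurable_prodMk_left
  have hi : IntegrableOn (fun y => uY u (x, y)) (Ioo a b) :=
    Measure.integrableOn_of_bounded (by simp) hmeas.aestronglyMeasurable hbound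
  have hi2 : IntegrableOn (fun y => uY u (x, y) ^ 2) (Ioo a b) := by
    refine Measure.integrableOn_of_bounded (M := B ^ 2) (by simp)
      (hmeas.pow_const 2).aestronglyMeasurable ?_
    filter_upwards [hbound] with y hy
    rw [norm_pow]
    exact pow_le_pow_left₀ (norm_nonneg _) hy 2
  have hui : IntegrableOn (fun y => u (x, y) ^ 2) (Ioo a b) :=
    ((hcont.pow 2).integrableOn_compact isCompact_Icc).mono_set Ioo_subset_Icc_self
  have hpoinc := hconc.setIntegral_sq_le hab hcont hua hderiv hi hi2
  obtain ⟨y₀, hy₀⟩ := nonempty_Ioo.2 hab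
  have hX : 0 < x - l.1 := sub_pos.2 (hlp _ (hmem y₀ hy₀))
  have hY : 0 < r.1 - x := sub_pos.2 (hpr _ (hmem y₀ hy₀))
  have hwC : b - a ≤ 2 * (C * (x - l.1)) := by
    refine sub_le_two_mul_of_forall_abs_sub_le (c := l.2) hab fun y hy => ?_
    simpa [abs_of_pos hX] using hC _ (hmem y hy)
  have hwD : b - a ≤ 2 * (D * (r.1 - x)) := by
    refine sub_le_two_mul_of_forall_abs_sub_le (c := r.2) hab fun y hy => ?_
    simpa [abs_sub_comm x, abs_of_pos hY] using hD _ (hmem y hy)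
  rw [hSab]
  set I := ∫ y in Ioo a b, uY u (x, y) ^ 2
  have hI : 0 ≤ I := integral_nonneg fun y => sq_nonneg _
  set α := 2 / (x - l.1) ^ 2 + 2 / (r.1 - x) ^ 2 with hα
  have hα0 : 0 ≤ α := by positivity
  have hαw : α * (b - a) ^ 2 ≤ 8 * C ^ 2 + 8 * D ^ 2 := by
    have h1 : (b - a) ^ 2 ≤ (2 * (C * (x - l.1))) ^ 2 :=
      pow_le_pow_left₀ (by linarith) hwC 2
    have h2 : (b - a) ^ 2 ≤ (2 * (D * (r.1 - x))) ^ 2 :=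
      pow_le_pow_left₀ (by linarith) hwD 2
    rw [hα, add_mul]
    refine add_le_add ?_ ?_
    · rw [div_mul_eq_mul_div, div_le_iff₀ (by positivity)]
      linarith
    · rw [div_mul_eq_mul_div, div_le_iff₀ (by positivity)]
      linarith
  calc ∫ y in Ioo a b, uX u (x, y) ^ 2
      ≤ ∫ y in Ioo a b, (α * u (x, y) ^ 2 + (2 * C ^ 2 + 2 * D ^ 2) * uY u (x, y) ^ 2) := by
        refine integral_mono_of_nonneg (ae_of_all _ fun y => sq_nonneg _)
          ((hui.const_mul _).add (hi2.const_mul _)) ?_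
        filter_upwards [hdiff, ae_restrict_mem measurableSet_Ioo] with y hy hyab
        have hm := hmem y hyab
        exact hu.uX_sq_le hm hl hr (hlp _ hm) (hpr _ hm) hy (hC _ hm) (hD _ hm)
    _ = α * (∫ y in Ioo a b, u (x, y) ^ 2) + (2 * C ^ 2 + 2 * D ^ 2) * I := by
        rw [integral_add (hui.const_mul _) (hi2.const_mul _), integral_const_mul,
          integral_const_mul]
    _ ≤ α * ((b - a) ^ 2 * I) + (2 * C ^ 2 + 2 * D ^ 2) * I := by gcongr
    _ = (α * (b - a) ^ 2 + (2 * C ^ 2 + 2 * D ^ 2)) * I := by ring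
    _ ≤ (8 * C ^ 2 + 8 * D ^ 2 + (2 * C ^ 2 + 2 * D ^ 2)) * I := by gcongr
    _ = 10 * (C ^ 2 + D ^ 2) * I := by ring

/-- The square of a directional derivative of `u ∈ U_Ω` is integrable on `int Ω`. -/
lemma MemU.integrableOn_fderiv_sq {Ω : Set (ℝ × ℝ)} {u : ℝ × ℝ → ℝ}
    (hbdd : Bornology.IsBounded Ω) (hu : MemU Ω u) {v : ℝ × ℝ} (hv : ‖v‖ ≤ 1) :
    IntegrableOn (fun p => fderiv ℝ u p v ^ 2) (interior Ω) := by
  obtain ⟨B, hB⟩ := hu.2.2.2.1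
  refine Measure.integrableOn_of_bounded (M := B ^ 2)
    (hbdd.subset interior_subset).measure_lt_top.ne
    ((measurable_fderiv_apply_const ℝ u v).pow_const 2).aestronglyMeasurable ?_
  filter_upwards [ae_restrict_of_ae_restrict_of_subset interior_subset hu.2.2.1,
    ae_restrict_mem isOpen_interior.measurableSet] with p hp hpΩ
  rw [norm_pow]
  exact pow_le_pow_left₀ (norm_nonneg _)
    ((abs_fderiv_apply_le u p hv).trans (hB p (interior_subset hpΩ) hp)) 2

lemma setIntegral_eq_integral_slice {O : Set (ℝ × ℝ)} (hO : MeasurableSet O) {f : ℝ × ℝ → ℝ}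
    (hf : IntegrableOn f O) :
    ∫ p in O, f p = ∫ x, ∫ y in Prod.mk x ⁻¹' O, f (x, y) := by
  rw [← integral_indicator hO, Measure.volume_eq_prod,
    integral_prod _ (by rw [← Measure.volume_eq_prod]; exact hf.integrable_indicator hO)]
  congr 1 with x
  rw [← integral_indicator (measurable_prodMk_left hO)]
  rfl

lemma integrable_integral_slice {O : Set (ℝ × ℝ)} (hO : MeasurableSet O) {f : ℝ × ℝ → ℝ}
    (hf : IntegrableOn f O) :
    Integrable fun x => ∫ y in Prod.mk x ⁻¹' O, f (x, y) := by
  have h := hf.integrable_indicator hO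
  rw [Measure.volume_eq_prod] at h
  convert h.integral_prod_left using 2 with x
  rw [← integral_indicator (measurable_prodMk_left hO)]
  rfl

/-- If both vertical support lines of `Ω` are angular, then there is a real constant
`K > 0` with `∫_Ω u_x² ≤ K ∫_Ω u_y²` for all `u ∈ U_Ω`. -/
theorem stmt1 (Ω : Set (ℝ × ℝ)) (hconv : Convex ℝ Ω) (hbdd : Bornology.IsBounded Ω)
    (hint : (interior Ω).Nonempty)
    (hangL : AngularSupportAt Ω (leftX Ω)) (hangR : AngularSupportAt Ω (rightX Ω)) :
    ∃ K : ℝ, 0 < K ∧ ∀ u : ℝ × ℝ → ℝ, MemU Ω u → Ix Ω u ≤ K * Iy Ω u := by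
  obtain ⟨l₂, hlcl, C, hC0, hC⟩ := hangL
  obtain ⟨r₂, hrcl, D, hD0, hD⟩ := hangR
  refine ⟨10 * (C ^ 2 + D ^ 2), by positivity, fun u hu => ?_⟩
  have hl : (leftX Ω, l₂) ∈ frontier Ω :=
    ⟨hlcl, fun h => (leftX_lt_of_mem_interior hbdd h).false⟩
  have hr : (rightX Ω, r₂) ∈ frontier Ω :=
    ⟨hrcl, fun h => (lt_rightX_of_mem_interior hbdd h).false⟩
  have hae : interior Ω =ᵐ[volume] Ω :=
    interior_ae_eq_of_null_frontier (hconv.addHaar_frontier volume)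
  have hOm : MeasurableSet (interior Ω) := isOpen_interior.measurableSet
  have hX : IntegrableOn (fun p => uX u p ^ 2) (interior Ω) :=
    hu.integrableOn_fderiv_sq hbdd (by simp)
  have hY : IntegrableOn (fun p => uY u p ^ 2) (interior Ω) :=
    hu.integrableOn_fderiv_sq hbdd (by simp)
  have hd : ∀ᵐ p, p ∈ interior Ω → DifferentiableAt ℝ u p :=
    (ae_restrict_iff' hOm).1 (ae_restrict_of_ae_restrict_of_subset interior_subset hu.2.2.1)
  rw [Measure.volume_eq_prod] at hd
  rw [Ix, Iy, ← setIntegral_congr_set hae, ← setIntegral_congr_set hae,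
    setIntegral_eq_integral_slice hOm hX, setIntegral_eq_integral_slice hOm hY,
    ← integral_const_mul]
  refine integral_mono_ae (integrable_integral_slice hOm hX)
    ((integrable_integral_slice hOm hY).const_mul _) ?_
  filter_upwards [Measure.ae_ae_of_ae_prod hd] with x hx
  exact hu.setIntegral_slice_le hconv hbdd hl hr
    (fun p hp => leftX_lt_of_mem_interior hbdd hp) (fun p hp => lt_rightX_of_mem_interior hbdd hp)
    (fun p hp => hC p (interior_subset hp)) (fun p hp => hD p (interior_subset hp)) hx
end

section
/- Let Ω ⊂ ℝ² be a convex bounded set with nonempty interior, and let f : ℝ² → ℝ be continuous and satisfy the expansion f(ζ₁,ζ₂) = f(0,0) + αζ₁ + βζ₂ − aζ₁² + bζ₂² + o(|ζ|²) as |ζ| → 0, with a > 0 and b > 0 (so f''(0,0) is indefinite with eigenvalues −2a < 0 < 2b, the positive eigendirection being the y-axis). If at least one of the two vertical support lines of Ω is not angular, then the zero function u ≡ 0 is not a local minimum of the functional F(u) = ∫_Ω f(∇u(x,y)) dx dy on U_Ω with respect to the C¹ norm. -/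
open MeasureTheory Real Set Filter Asymptotics

open scoped NNReal

/-- The energy density `a u_x² - b u_y²`. -/
noncomputable def energyDensity (a b : ℝ) (u : ℝ × ℝ → ℝ) (p : ℝ × ℝ) : ℝ :=
  a * uX u p ^ 2 - b * uY u p ^ 2

lemma LipschitzWith.abs_uX_le {K : ℝ≥0} {u : ℝ × ℝ → ℝ} (hu : LipschitzWith K u) (p : ℝ × ℝ) :
    |uX u p| ≤ K := by
  have h := (fderiv ℝ u p).le_of_opNorm_le (norm_fderiv_le_of_lipschitz ℝ hu) (1, 0)
  simpa [uX, Prod.norm_def] using h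

lemma LipschitzWith.abs_uY_le {K : ℝ≥0} {u : ℝ × ℝ → ℝ} (hu : LipschitzWith K u) (p : ℝ × ℝ) :
    |uY u p| ≤ K := by
  have h := (fderiv ℝ u p).le_of_opNorm_le (norm_fderiv_le_of_lipschitz ℝ hu) (0, 1)
  simpa [uY, Prod.norm_def] using h

lemma measurable_uX (u : ℝ × ℝ → ℝ) : Measurable (uX u) := measurable_fderiv_apply_const ℝ u _

lemma measurable_uY (u : ℝ × ℝ → ℝ) : Measurable (uY u) := measurable_fderiv_apply_const ℝ u _

lemma uX_smul (ε : ℝ) (u : ℝ × ℝ → ℝ) (p : ℝ × ℝ) : uX (ε • u) p = ε * uX u p := by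
  simp [uX, fderiv_const_smul_field]

lemma uY_smul (ε : ℝ) (u : ℝ × ℝ → ℝ) (p : ℝ × ℝ) : uY (ε • u) p = ε * uY u p := by
  simp [uY, fderiv_const_smul_field]

/-- A compactly supported Lipschitz function has derivatives of zero mean. -/
lemma LipschitzWith.integral_fderiv_apply_eq_zero {K : ℝ≥0} {u : ℝ × ℝ → ℝ}
    (hu : LipschitzWith K u) (hc : HasCompactSupport u) (v : ℝ × ℝ) :
    ∫ p, fderiv ℝ u p v = 0 := by
  have h := LipschitzWith.integral_lineDeriv_mul_eq (μ := volume)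
    (LipschitzWith.const (1 : ℝ) : LipschitzWith 0 fun _ : ℝ × ℝ => (1 : ℝ)) hu hc (-v)
  simp only [neg_neg, mul_one, lineDeriv, deriv_const, zero_mul, integral_zero] at h
  refine Eq.trans (integral_congr_ae ?_) h.symm
  filter_upwards [hu.ae_differentiableAt] with p hp
  exact hp.lineDeriv_eq_fderiv.symm

lemma memU_of_lipschitz {Ω : Set (ℝ × ℝ)} {K : ℝ≥0} {u : ℝ × ℝ → ℝ} (hu : LipschitzWith K u)
    (hcc : ConcaveOn ℝ Ω u) (hz : ∀ p ∉ interior Ω, u p = 0) : MemU Ω u :=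
  ⟨hu.continuous.continuousOn, hcc, ae_restrict_of_ae hu.ae_differentiableAt,
    ⟨K, fun _ _ _ => norm_fderiv_le_of_lipschitz ℝ hu⟩, fun _ hp => hz _ hp.2⟩

lemma C1Norm_le {Ω : Set (ℝ × ℝ)} {u : ℝ × ℝ → ℝ} {K : ℝ≥0} {M : ℝ} (hu : LipschitzWith K u)
    (hM : 0 ≤ M) (huM : ∀ p, |u p| ≤ M) : C1Norm Ω u ≤ M + K + K := by
  unfold C1Norm
  gcongr
  · exact Real.sSup_le (by rintro _ ⟨p, -, rfl⟩; exact huM p) hM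
  · exact Real.sSup_le (by rintro _ ⟨p, -, rfl⟩; exact hu.abs_uX_le p) K.2
  · exact Real.sSup_le (by rintro _ ⟨p, -, rfl⟩; exact hu.abs_uY_le p) K.2

/-- If some admissible `w` has positive energy, its small multiples decrease `F` below `F(0)`. -/
lemma not_zeroIsLocalMin_of_energy_pos {Ω : Set (ℝ × ℝ)} (hbdd : Bornology.IsBounded Ω)
    {f : ℝ × ℝ → ℝ} (hf : Continuous f) {α β a b : ℝ}
    (hTaylor : (fun ζ : ℝ × ℝ =>
        f ζ - (f 0 + α * ζ.1 + β * ζ.2 - a * ζ.1 ^ 2 + b * ζ.2 ^ 2))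
        =o[nhds (0 : ℝ × ℝ)] fun ζ : ℝ × ℝ => ‖ζ‖ ^ 2)
    {K : ℝ≥0} {w : ℝ × ℝ → ℝ} (hw : LipschitzWith K w) (hcc : ConcaveOn ℝ Ω w)
    (hnn : ∀ p, 0 ≤ w p) (hz : ∀ p ∉ interior Ω, w p = 0)
    (hpos : 0 < ∫ p in Ω, energyDensity a b w p) : ¬ ZeroIsLocalMin Ω f := by
  rintro ⟨δ, hδ, hmin⟩
  have hcomp : HasCompactSupport w :=
    HasCompactSupport.intro hbdd.isCompact_closure fun p hp =>
      hz p fun h => hp (subset_closure (interior_subset h))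
  obtain ⟨M, hM⟩ := hw.continuous.bounded_above_of_compact_support hcomp
  have hM0 : 0 ≤ M := (norm_nonneg _).trans (hM 0)
  have hfin : IsFiniteMeasure (volume.restrict Ω) :=
    isFiniteMeasure_restrict.2 hbdd.measure_lt_top.ne
  have hder0 : ∀ p ∉ Ω, fderiv ℝ w p = 0 := fun p hp => by
    refine IsLocalMin.fderiv_eq_zero (Eventually.of_forall fun q => ?_)
    rw [hz p fun h => hp (interior_subset h)]
    exact hnn q
  have hX0 : ∫ p in Ω, uX w p = 0 := by
    rw [setIntegral_eq_integral_of_forall_compl_eq_zero fun p hp => by simp [uX, hder0 p hp]]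
    exact hw.integral_fderiv_apply_eq_zero hcomp _
  have hY0 : ∫ p in Ω, uY w p = 0 := by
    rw [setIntegral_eq_integral_of_forall_compl_eq_zero fun p hp => by simp [uY, hder0 p hp]]
    exact hw.integral_fderiv_apply_eq_zero hcomp _
  have hXi : Integrable (uX w) (volume.restrict Ω) :=
    Integrable.of_bound (measurable_uX w).aestronglyMeasurable K
      (Eventually.of_forall hw.abs_uX_le)
  have hYi : Integrable (uY w) (volume.restrict Ω) :=
    Integrable.of_bound (measurable_uY w).aestronglyMeasurable K
      (Eventually.of_forall hw.abs_uY_le)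
  have hEi : Integrable (energyDensity a b w) (volume.restrict Ω) := by
    by_contra h
    rw [integral_undef h] at hpos
    exact hpos.false
  set c := ∫ p in Ω, energyDensity a b w p with hc
  set V := volume.real Ω with hV
  have hV0 : 0 ≤ V := measureReal_nonneg
  set η := c / (2 * (K ^ 2 * V + 1)) with hη
  have hden : 0 < K ^ 2 * V + 1 := by positivity
  have hη0 : 0 < η := by positivity
  have hηc : η * (K ^ 2 * V) < c := by
    rw [hη, div_mul_eq_mul_div, div_lt_iff₀ (by positivity)]
    nlinarith [mul_nonneg (sq_nonneg (K : ℝ)) hV0]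
  obtain ⟨r, hr, hball⟩ := Metric.eventually_nhds_iff_ball.1 (hTaylor.bound hη0)
  obtain ⟨ε, hε, hεr, hεδ⟩ : ∃ ε : ℝ, 0 < ε ∧ ε * K < r ∧ ε * (M + K + K) < δ := by
    have h1 : Tendsto (fun ε : ℝ => ε * K) (nhdsWithin 0 (Ioi 0)) (nhds 0) :=
      ((continuous_id.mul continuous_const).tendsto' 0 0 (by simp)).mono_left nhdsWithin_le_nhds
    have h2 : Tendsto (fun ε : ℝ => ε * (M + K + K)) (nhdsWithin 0 (Ioi 0)) (nhds 0) :=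
      ((continuous_id.mul continuous_const).tendsto' 0 0 (by simp)).mono_left nhdsWithin_le_nhds
    obtain ⟨ε, h⟩ := ((h1.eventually_lt_const hr).and ((h2.eventually_lt_const hδ).and
      self_mem_nhdsWithin)).exists
    exact ⟨ε, h.2.2, h.1, h.2.1⟩
  have hlip : LipschitzWith (‖ε‖₊ * K) (ε • w) := (lipschitzWith_smul ε).comp hw
  have hεn : ((‖ε‖₊ * K : ℝ≥0) : ℝ) = ε * K := by
    simp [abs_of_pos hε]
  have hmem : MemU Ω (ε • w) :=
    memU_of_lipschitz hlip (hcc.smul hε.le) fun p hp => by simp [hz p hp]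
  have hnorm : C1Norm Ω (ε • w) < δ := by
    refine (C1Norm_le (M := ε * M) hlip (by positivity) fun p => ?_).trans_lt ?_
    · have := hM p
      simp only [Pi.smul_apply, smul_eq_mul, abs_mul, abs_of_pos hε]
      gcongr
      exact this
    · rw [hεn]; linarith
  have hF := hmin _ hmem hnorm
  have hF0 : Fres Ω f (fun _ => 0) = V * f 0 := by
    have : ((0 : ℝ), (0 : ℝ)) = 0 := rfl
    simp [Fres, uX, uY, this, hV, Measure.real]
  have hsmall : ∀ p, ‖(uX (ε • w) p, uY (ε • w) p)‖ ≤ ε * K := fun p => by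
    rw [← hεn]
    exact max_le (hlip.abs_uX_le p) (hlip.abs_uY_le p)
  set g : ℝ × ℝ → ℝ := fun p => f 0 + (α * ε) * uX w p + (β * ε) * uY w p
    - ε ^ 2 * energyDensity a b w p with hg
  have hgi : Integrable g (volume.restrict Ω) :=
    (((integrable_const _).add (hXi.const_mul _)).add (hYi.const_mul _)).sub (hEi.const_mul _)
  have hgI : ∫ p in Ω, g p = V * f 0 - ε ^ 2 * c := by
    simp only [hg]
    rw [integral_sub (by fun_prop) (by fun_prop), integral_add (by fun_prop) (by fun_prop),
      integral_add (by fun_prop) (by fun_prop)]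
    simp only [integral_const_mul, hX0, hY0]
    simp [hV, Measure.real, hc]
  have hdiff : ∀ p, |f (uX (ε • w) p, uY (ε • w) p) - g p| ≤ η * (ε * K) ^ 2 := fun p => by
    have h := hball (uX (ε • w) p, uY (ε • w) p)
      (mem_ball_zero_iff.2 ((hsmall p).trans_lt hεr))
    have h2 : ‖(uX (ε • w) p, uY (ε • w) p)‖ ^ 2 ≤ (ε * K) ^ 2 := by gcongr; exact hsmall p
    rw [norm_pow, norm_norm, Real.norm_eq_abs] at h
    refine (le_of_eq ?_).trans (h.trans (mul_le_mul_of_nonneg_left h2 hη0.le))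
    simp only [hg, uX_smul, uY_smul, energyDensity]
    ring_nf
  have hfm : Measurable fun p => f (uX (ε • w) p, uY (ε • w) p) :=
    hf.measurable.comp ((measurable_uX _).prodMk (measurable_uY _))
  have hdi : Integrable (fun p => f (uX (ε • w) p, uY (ε • w) p) - g p) (volume.restrict Ω) :=
    Integrable.of_bound (hfm.aestronglyMeasurable.sub hgi.aestronglyMeasurable) _
      (Eventually.of_forall hdiff)
  have hle : ∫ p in Ω, (f (uX (ε • w) p, uY (ε • w) p) - g p) ≤ η * (ε * K) ^ 2 * V := by
    refine (integral_mono hdi (integrable_const _)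
      fun p => (le_abs_self _).trans (hdiff p)).trans_eq ?_
    simp [hV, Measure.real, mul_comm]
  have hFeq : Fres Ω f (ε • w) = (∫ p in Ω, (f (uX (ε • w) p, uY (ε • w) p) - g p))
      + ∫ p in Ω, g p := by
    rw [← integral_add hdi hgi]
    simp [Fres]
  rw [hF0, hFeq, hgI] at hF
  nlinarith [mul_lt_mul_of_pos_left hηc (pow_pos hε 2)]

lemma LipschitzWith.integrable_energyDensity {K : ℝ≥0} {u : ℝ × ℝ → ℝ} (hu : LipschitzWith K u)
    (a b : ℝ) (μ : Measure (ℝ × ℝ)) [IsFiniteMeasure μ] : Integrable (energyDensity a b u) μ := by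
  have hsq : ∀ g : ℝ × ℝ → ℝ, Measurable g → (∀ p, |g p| ≤ K) →
      Integrable (fun p => g p ^ 2) μ := fun g hg hgK =>
    Integrable.of_bound (hg.pow_const 2).aestronglyMeasurable (K ^ 2)
      (Eventually.of_forall fun p => by
        rw [norm_pow]
        exact pow_le_pow_left₀ (norm_nonneg _) (hgK p) 2)
  exact ((hsq _ (measurable_uX u) hu.abs_uX_le).const_mul a).sub
    ((hsq _ (measurable_uY u) hu.abs_uY_le).const_mul b)

/-- Differentiable functions touching at a point have the same derivative there. -/
lemma fderiv_eq_of_eventually_le {u v : ℝ × ℝ → ℝ} {p : ℝ × ℝ} (hu : DifferentiableAt ℝ u p)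
    (hv : DifferentiableAt ℝ v p) (hle : ∀ᶠ q in nhds p, u q ≤ v q) (heq : u p = v p) :
    fderiv ℝ u p = fderiv ℝ v p := by
  have hmin : IsLocalMin (v - u) p := by
    filter_upwards [hle] with q hq
    simp only [Pi.sub_apply, heq, sub_self]
    linarith
  have h := hmin.fderiv_eq_zero
  rw [fderiv_sub hv hu, sub_eq_zero] at h
  exact h.symm

section Epigraph

variable {σ : ℝ} {k : ℝ≥0} {φ : ℝ → ℝ}

lemma uX_epigraph {p : ℝ × ℝ} (hp : DifferentiableAt ℝ (fun q : ℝ × ℝ => σ * q.1 - φ q.2) p) :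
    uX (fun q : ℝ × ℝ => σ * q.1 - φ q.2) p = σ := by
  have h : HasLineDerivAt ℝ (fun q : ℝ × ℝ => σ * q.1 - φ q.2) σ p (1, 0) := by
    have h' := (((hasDerivAt_id (0 : ℝ)).const_add p.1).const_mul σ).sub_const (φ p.2)
    simpa [HasLineDerivAt] using h'
  exact hp.lineDeriv_eq_fderiv.symm.trans h.lineDeriv

lemma abs_uY_epigraph_le (hφ : LipschitzWith k φ) {p : ℝ × ℝ}
    (hp : DifferentiableAt ℝ (fun q : ℝ × ℝ => σ * q.1 - φ q.2) p) :
    |uY (fun q : ℝ × ℝ => σ * q.1 - φ q.2) p| ≤ k := by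
  rw [uY, ← hp.lineDeriv_eq_fderiv, lineDeriv, ← Real.norm_eq_abs]
  refine norm_deriv_le_of_lipschitz (LipschitzWith.of_dist_le_mul fun s t => ?_)
  have h := hφ.dist_le_mul (p.2 + s) (p.2 + t)
  simp only [Real.dist_eq, add_sub_add_left_eq_sub] at h ⊢
  simpa [abs_sub_comm] using h

lemma isOpen_epigraph_strip (hφ : Continuous φ) (σ y₀ ρ τ : ℝ) :
    IsOpen {p : ℝ × ℝ | |p.2 - y₀| < ρ ∧ φ p.2 < σ * p.1 ∧ σ * p.1 < φ p.2 + τ} := by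
  refine IsOpen.and ?_ (IsOpen.and ?_ ?_) <;> exact isOpen_lt (by fun_prop) (by fun_prop)

lemma volume_epigraph_strip (hσ : σ = 1 ∨ σ = -1) (hφ : Continuous φ) (y₀ ρ τ : ℝ) :
    volume {p : ℝ × ℝ | |p.2 - y₀| < ρ ∧ φ p.2 < σ * p.1 ∧ σ * p.1 < φ p.2 + τ}
      = ENNReal.ofReal τ * ENNReal.ofReal (2 * ρ) := by
  rw [Measure.volume_eq_prod, Measure.prod_apply_symm (isOpen_epigraph_strip hφ ..).measurableSet]
  have hslice : ∀ y, volume ((fun x : ℝ => (x, y)) ⁻¹'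
      {p : ℝ × ℝ | |p.2 - y₀| < ρ ∧ φ p.2 < σ * p.1 ∧ σ * p.1 < φ p.2 + τ})
      = (Ioo (y₀ - ρ) (y₀ + ρ)).indicator (fun _ => ENNReal.ofReal τ) y := fun y => by
    by_cases hy : |y - y₀| < ρ
    · have hy' : y ∈ Ioo (y₀ - ρ) (y₀ + ρ) := by
        rw [abs_lt] at hy; constructor <;> linarith
      rw [indicator_of_mem hy']
      rcases hσ with rfl | rfl
      · have : ((fun x : ℝ => (x, y)) ⁻¹'
          {p : ℝ × ℝ | |p.2 - y₀| < ρ ∧ φ p.2 < 1 * p.1 ∧ 1 * p.1 < φ p.2 + τ})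
            = Ioo (φ y) (φ y + τ) := by ext x; simp [hy]
        rw [this, Real.volume_Ioo]; congr 1; ring
      · have : ((fun x : ℝ => (x, y)) ⁻¹'
          {p : ℝ × ℝ | |p.2 - y₀| < ρ ∧ φ p.2 < -1 * p.1 ∧ -1 * p.1 < φ p.2 + τ})
            = Ioo (-(φ y + τ)) (-φ y) := by
          ext x
          simp only [mem_preimage, mem_ofPred_eq, hy, true_and, mem_Ioo]
          constructor <;> rintro ⟨h1, h2⟩ <;> constructor <;> linarith
        rw [this, Real.volume_Ioo]; congr 1; ring
    · have hy' : y ∉ Ioo (y₀ - ρ) (y₀ + ρ) := fun h => hy (by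
        rw [abs_lt]; constructor <;> linarith [h.1, h.2])
      rw [indicator_of_notMem hy']
      simp [hy]
  simp_rw [hslice]
  rw [lintegral_indicator measurableSet_Ioo, setLIntegral_const, Real.volume_Ioo]
  congr 2; ring

lemma lipschitzWith_epigraph (hσ : σ = 1 ∨ σ = -1) (hφ : LipschitzWith k φ) :
    LipschitzWith (1 + k) fun q : ℝ × ℝ => σ * q.1 - φ q.2 := by
  have h1 : LipschitzWith 1 fun q : ℝ × ℝ => σ * q.1 := by
    rcases hσ with rfl | rfl
    · simpa using LipschitzWith.prod_fst (α := ℝ) (β := ℝ)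
    · simpa [LipschitzWith, edist_neg_neg] using LipschitzWith.prod_fst (α := ℝ) (β := ℝ)
  have h2 := hφ.comp (LipschitzWith.prod_snd (α := ℝ) (β := ℝ))
  rw [mul_one] at h2
  exact h1.sub h2

/-- A steep `k`-Lipschitz part of the boundary, together with a concave barrier `B` covering the
rest of it, yields an admissible function of positive energy. -/
lemma exists_energy_pos {Ω : Set (ℝ × ℝ)} (hconv : Convex ℝ Ω) (hbdd : Bornology.IsBounded Ω)
    {a b : ℝ} (ha : 0 < a) (hb : 0 < b) (hk : b * k ^ 2 ≤ a / 2) (hσ : σ = 1 ∨ σ = -1)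
    (hφ : LipschitzWith k φ) (hφc : ConvexOn ℝ univ φ) {B : ℝ × ℝ → ℝ} {L : ℝ≥0}
    (hB : LipschitzWith L B) (hBc : ConcaveOn ℝ univ B)
    (hΩ : ∀ x ∈ Ω, φ x.2 ≤ σ * x.1 ∧ 0 ≤ B x)
    (hint : ∀ x : ℝ × ℝ, φ x.2 < σ * x.1 → 0 < B x → x ∈ interior Ω)
    {β ρ δ y₀ : ℝ} (hβ : 0 < β) (hρ : 0 < ρ) (hδ : 0 < δ)
    (hstrip : ∀ x : ℝ × ℝ, |x.2 - y₀| < ρ → φ x.2 < σ * x.1 → σ * x.1 < φ x.2 + δ → β ≤ B x) :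
    ∃ (K : ℝ≥0) (w : ℝ × ℝ → ℝ), LipschitzWith K w ∧ ConcaveOn ℝ Ω w ∧ (∀ p, 0 ≤ w p) ∧
      (∀ p ∉ interior Ω, w p = 0) ∧ 0 < ∫ p in Ω, energyDensity a b w p := by
  have hfin : IsFiniteMeasure (volume.restrict Ω) :=
    isFiniteMeasure_restrict.2 hbdd.measure_lt_top.ne
  set V := volume.real Ω with hV
  have hV0 : 0 ≤ V := measureReal_nonneg
  set t : ℝ := b * L ^ 2 * V / (a * ρ * β) + β / δ + 1 with ht
  have ht0 : 0 < t := by positivity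
  have htδ : β / t ≤ δ := by
    rw [div_le_iff₀ ht0]
    have : β / δ ≤ t := by
      have : 0 ≤ b * L ^ 2 * V / (a * ρ * β) := by positivity
      linarith
    rw [div_le_iff₀ hδ] at this
    linarith
  have htE : b * L ^ 2 * V < a * ρ * β * t := by
    have : b * L ^ 2 * V / (a * ρ * β) < t := by
      have : 0 < β / δ := by positivity
      linarith
    rw [div_lt_iff₀ (by positivity)] at this
    linarith
  set G : ℝ × ℝ → ℝ := fun q => σ * q.1 - φ q.2 with hG
  have hGl : LipschitzWith (1 + k) G := lipschitzWith_epigraph hσ hφ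
  have hGc : ConcaveOn ℝ univ G := by
    have h1 : ConcaveOn ℝ univ fun q : ℝ × ℝ => σ * q.1 :=
      (σ • LinearMap.fst ℝ ℝ ℝ).concaveOn convex_univ
    exact h1.sub (hφc.comp_linearMap (LinearMap.snd ℝ ℝ ℝ))
  set w₀ : ℝ × ℝ → ℝ := fun p => min (t * G p) (B p) with hw₀
  set w : ℝ × ℝ → ℝ := fun p => max 0 (w₀ p) with hw
  have hwl : LipschitzWith (max (‖t‖₊ * (1 + k)) L) w :=
    (((lipschitzWith_smul t).comp hGl).min hB).const_max 0
  have hwΩ : ∀ p ∈ Ω, w p = w₀ p := fun p hp =>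
    max_eq_right (le_min (mul_nonneg ht0.le (sub_nonneg.2 (hΩ p hp).1)) (hΩ p hp).2)
  have hwc : ConcaveOn ℝ Ω w := by
    have h : ConcaveOn ℝ Ω w₀ :=
      ((hGc.smul ht0.le).inf hBc).subset (subset_univ _) hconv
    exact h.congr fun p hp => (hwΩ p hp).symm
  have hwz : ∀ p ∉ interior Ω, w p = 0 := fun p hp => by
    refine max_eq_left (not_lt.1 fun h => hp ?_)
    obtain ⟨h1, h2⟩ := lt_min_iff.1 h
    exact hint p (sub_pos.1 (pos_of_mul_pos_right h1 ht0.le)) h2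
  refine ⟨_, w, hwl, hwc, fun p => le_max_left _ _, hwz, ?_⟩
  set R : Set (ℝ × ℝ) :=
    {p | |p.2 - y₀| < ρ ∧ φ p.2 < σ * p.1 ∧ σ * p.1 < φ p.2 + β / t} with hR
  have hRvol : volume.real R = β / t * (2 * ρ) := by
    rw [Measure.real, hR, volume_epigraph_strip hσ hφ.continuous, ENNReal.toReal_mul,
      ENNReal.toReal_ofReal (by positivity), ENNReal.toReal_ofReal (by positivity)]
  have hRm : MeasurableSet R := (isOpen_epigraph_strip hφ.continuous ..).measurableSet
  have hRB : ∀ p ∈ R, β ≤ B p := fun p hp => hstrip p hp.1 hp.2.1 (by linarith [hp.2.2])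
  have hRΩ : R ⊆ Ω := fun p hp => interior_subset (hint p hp.2.1 (hβ.trans_le (hRB p hp)))
  have hRG : ∀ p ∈ R, t * G p < B p := fun p hp => by
    have : G p < β / t := by simp only [hG]; linarith [hp.2.2]
    rw [lt_div_iff₀ ht0] at this
    linarith [hRB p hp]
  have hmem : ∀ᵐ p ∂(volume.restrict Ω), p ∈ interior Ω := by
    have h1 : ∀ᵐ p ∂(volume.restrict Ω), p ∉ frontier Ω :=
      ae_restrict_of_ae (measure_eq_zero_iff_ae_notMem.1 (hconv.addHaar_frontier volume))
    filter_upwards [h1, ae_restrict_mem₀ (hconv.nullMeasurableSet volume)] with p hp hp'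
    by_contra h
    exact hp ⟨subset_closure hp', h⟩
  have hpt : ∀ᵐ p ∂(volume.restrict Ω),
      R.indicator (fun _ => a / 2 * t ^ 2) p - b * L ^ 2 ≤ energyDensity a b w p := by
    filter_upwards [hmem, ae_restrict_of_ae hGl.ae_differentiableAt,
      ae_restrict_of_ae hB.ae_differentiableAt, ae_restrict_of_ae hwl.ae_differentiableAt]
      with p hp hGp hBp hwp
    have hnear : ∀ᶠ q in nhds p, w q = w₀ q := by
      filter_upwards [isOpen_interior.mem_nhds hp] with q hq using hwΩ q (interior_subset hq)
    have hbL : 0 ≤ b * (L : ℝ) ^ 2 := by positivity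
    by_cases hcase : t * G p ≤ B p
    · have hf : fderiv ℝ w p = t • fderiv ℝ G p := by
        have h := fderiv_eq_of_eventually_le (v := t • G) hwp (hGp.const_smul t)
          (hnear.mono fun q hq => hq.trans_le (min_le_left _ _))
          (hnear.self_of_nhds.trans (min_eq_left hcase))
        rwa [fderiv_const_smul hGp] at h
      have hx : uX w p = t * σ := by
        rw [← uX_epigraph hGp, uX, hf]; rfl
      have hy : uY w p ^ 2 ≤ t ^ 2 * k ^ 2 := by
        have : uY w p = t * uY G p := by rw [uY, hf]; rfl
        rw [this, mul_pow]
        have h2 := abs_uY_epigraph_le hφ hGp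
        have : uY G p ^ 2 ≤ (k : ℝ) ^ 2 := sq_le_sq' (by linarith [neg_abs_le (uY G p)])
          ((le_abs_self _).trans h2)
        gcongr
      have hx2 : uX w p ^ 2 = t ^ 2 := by
        rw [hx]; rcases hσ with h | h <;> rw [h] <;> ring
      have hE : a / 2 * t ^ 2 ≤ energyDensity a b w p := by
        rw [energyDensity, hx2]
        nlinarith [mul_le_mul_of_nonneg_left hy hb.le,
          mul_le_mul_of_nonneg_right hk (sq_nonneg t)]
      have hi : R.indicator (fun _ => a / 2 * t ^ 2) p ≤ a / 2 * t ^ 2 :=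
        indicator_apply_le' (fun _ => le_rfl) fun _ => by positivity
      linarith
    · have hf : fderiv ℝ w p = fderiv ℝ B p :=
        fderiv_eq_of_eventually_le hwp hBp
          (hnear.mono fun q hq => hq.trans_le (min_le_right _ _))
          (hnear.self_of_nhds.trans (min_eq_right (not_le.1 hcase).le))
      rw [indicator_of_notMem fun h => hcase (hRG p h).le, energyDensity]
      have hy : uY w p ^ 2 ≤ (L : ℝ) ^ 2 := by
        have h2 := hB.abs_uY_le p
        rw [uY, ← hf] at h2
        exact sq_le_sq' (by linarith [neg_abs_le (uY w p), show |uY w p| ≤ L from h2])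
          ((le_abs_self _).trans h2)
      nlinarith [mul_nonneg ha.le (sq_nonneg (uX w p)), mul_le_mul_of_nonneg_left hy hb.le]
  have hii : Integrable (R.indicator fun _ => a / 2 * t ^ 2) (volume.restrict Ω) :=
    (integrable_const _).indicator hRm
  have hle := integral_mono_ae (hii.sub (integrable_const (b * (L : ℝ) ^ 2)))
    (hwl.integrable_energyDensity a b _) hpt
  have hval : ∫ p in Ω, (R.indicator (fun _ => a / 2 * t ^ 2) p - b * (L : ℝ) ^ 2)
      = a * ρ * β * t - b * L ^ 2 * V := by
    rw [integral_sub hii (integrable_const _), integral_indicator hRm,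
      Measure.restrict_restrict hRm, inter_eq_left.2 hRΩ, setIntegral_const, setIntegral_const,
      hRvol, smul_eq_mul, smul_eq_mul]
    field_simp
    ring
  have hle' : a * ρ * β * t - b * L ^ 2 * V ≤ ∫ p in Ω, energyDensity a b w p :=
    hval.symm.trans_le hle
  linarith

end Epigraph

section Envelope

/-- The largest `k`-Lipschitz minorant of the part of `∂Ω` facing the direction `-σ`, as a
graph `σ x = φ y`. -/
noncomputable def lipEnvelope (Ω : Set (ℝ × ℝ)) (σ : ℝ) (k : ℝ≥0) (y : ℝ) : ℝ :=
  ⨅ z : Ω, (σ * z.1.1 + k * |y - z.1.2|)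

variable {Ω : Set (ℝ × ℝ)} {σ X₀ : ℝ} {k : ℝ≥0}

lemma lipEnvelope_le (hX : ∀ z ∈ Ω, X₀ ≤ σ * z.1) {z : ℝ × ℝ} (hz : z ∈ Ω) (y : ℝ) :
    lipEnvelope Ω σ k y ≤ σ * z.1 + k * |y - z.2| := by
  refine ciInf_le (f := fun z : Ω => σ * z.1.1 + k * |y - z.1.2|) ⟨X₀, ?_⟩ ⟨z, hz⟩
  rintro _ ⟨z, rfl⟩
  have : 0 ≤ (k : ℝ) * |y - z.1.2| := by positivity
  linarith [hX z.1 z.2]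

lemma le_lipEnvelope (hne : Ω.Nonempty) {c y : ℝ}
    (h : ∀ z ∈ Ω, c ≤ σ * z.1 + k * |y - z.2|) : c ≤ lipEnvelope Ω σ k y :=
  have := hne.to_subtype
  le_ciInf fun z => h z.1 z.2

lemma lipschitzWith_lipEnvelope (hne : Ω.Nonempty) (hX : ∀ z ∈ Ω, X₀ ≤ σ * z.1) :
    LipschitzWith k (lipEnvelope Ω σ k) := by
  refine LipschitzWith.of_le_add_mul k fun y y' => ?_
  rw [← sub_le_iff_le_add]
  refine le_lipEnvelope hne fun z hz => ?_
  have h1 := lipEnvelope_le (k := k) hX hz y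
  have h2 : (k : ℝ) * |y - z.2| ≤ k * (|y - y'| + |y' - z.2|) := by
    gcongr
    exact abs_sub_le _ _ _
  rw [Real.dist_eq]
  linarith

lemma convexOn_lipEnvelope (hconv : Convex ℝ Ω) (hne : Ω.Nonempty)
    (hX : ∀ z ∈ Ω, X₀ ≤ σ * z.1) : ConvexOn ℝ univ (lipEnvelope Ω σ k) := by
  refine ⟨convex_univ, fun y₁ _ y₂ _ a b ha hb hab => le_of_forall_pos_le_add fun ε hε => ?_⟩
  have := hne.to_subtype
  have hex : ∀ y, ∃ z ∈ Ω, σ * z.1 + k * |y - z.2| < lipEnvelope Ω σ k y + ε := fun y => by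
    obtain ⟨z, hz⟩ := exists_lt_of_ciInf_lt (lt_add_of_pos_right (lipEnvelope Ω σ k y) hε)
    exact ⟨z.1, z.2, hz⟩
  obtain ⟨z₁, hz₁, h₁⟩ := hex y₁
  obtain ⟨z₂, hz₂, h₂⟩ := hex y₂
  have h := lipEnvelope_le (k := k) hX (hconv hz₁ hz₂ ha hb hab) (a • y₁ + b • y₂)
  have habs : |a * y₁ + b * y₂ - (a * z₁.2 + b * z₂.2)| ≤ a * |y₁ - z₁.2| + b * |y₂ - z₂.2| := by
    have := abs_add_le (a * (y₁ - z₁.2)) (b * (y₂ - z₂.2))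
    rw [abs_mul, abs_mul, abs_of_nonneg ha, abs_of_nonneg hb] at this
    refine le_trans (le_of_eq ?_) this
    congr 1; ring
  simp only [smul_eq_mul, Prod.fst_add, Prod.snd_add, Prod.smul_fst, Prod.smul_snd] at h ⊢
  have hb' : b = 1 - a := by linarith
  have h3 := mul_le_mul_of_nonneg_left habs k.2
  have h4 := mul_le_mul_of_nonneg_left h₁.le ha
  have h5 := mul_le_mul_of_nonneg_left h₂.le hb
  have h6 : a * ε + b * ε = ε := by rw [← add_mul, hab, one_mul]
  have h7 : ((k : ℝ≥0).val : ℝ) = (k : ℝ) := rfl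
  rw [h7] at h3
  linarith

lemma apply_eq_mul_add_mul (hσ : σ = 1 ∨ σ = -1) (g : StrongDual ℝ (ℝ × ℝ)) (v : ℝ × ℝ) :
    g v = (σ * g (1, 0)) * (σ * v.1) + g (0, 1) * v.2 := by
  have hv : v = v.1 • ((1 : ℝ), (0 : ℝ)) + v.2 • ((0 : ℝ), (1 : ℝ)) := by
    ext <;> simp
  have hσσ : σ * σ = 1 := by rcases hσ with rfl | rfl <;> norm_num
  conv_lhs => rw [hv]
  simp only [map_add, map_smul, smul_eq_mul]
  linear_combination (-(g (1, 0) * v.1)) * hσσ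

lemma preimage_add_convexHull_insert_mem_nhds {m e : ℝ × ℝ} (hm : m ∈ interior Ω) :
    (fun v => m + v) ⁻¹' convexHull ℝ (insert e Ω) ∈ nhds 0 := by
  refine (continuous_const.add continuous_id).continuousAt ?_
  show _ ∈ nhds (m + (0 : ℝ × ℝ))
  rw [add_zero]
  exact mem_of_superset (mem_interior_iff_mem_nhds.1 hm)
    ((subset_insert _ _).trans (subset_convexHull ℝ _))

/-- A point outside `interior Ω` but inside the convex hull of `Ω ∪ {e}` lies beyond the envelope,
provided every functional larger at `e` than on `Ω` is steep. -/
lemma le_lipEnvelope_of_separated (hσ : σ = 1 ∨ σ = -1) (hconv : Convex ℝ Ω) {m e x : ℝ × ℝ}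
    (hm : m ∈ interior Ω)
    (hsteep : ∀ g : StrongDual ℝ (ℝ × ℝ), (∀ z ∈ Ω, g z < g e) →
      |g (0, 1)| ≤ k * -(σ * g (1, 0)) ∧ σ * g (1, 0) < 0)
    (hx : x ∉ interior Ω)
    (hg : gauge ((fun v => m + v) ⁻¹' convexHull ℝ (insert e Ω)) (x - m) < 1) :
    σ * x.1 ≤ lipEnvelope Ω σ k x.2 := by
  have hmΩ := interior_subset hm
  obtain ⟨g, hgx⟩ := geometric_hahn_banach_open_point hconv.interior isOpen_interior hx
  have hgΩ : ∀ z ∈ Ω, g z ≤ g x := fun z hz => by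
    have hsub : closure (interior Ω) ⊆ {z | g z ≤ g x} :=
      closure_minimal (fun z hz => (hgx z hz).le) (isClosed_le g.continuous continuous_const)
    rw [hconv.closure_interior_eq_closure_of_nonempty_interior ⟨m, hm⟩] at hsub
    exact hsub (subset_closure hz)
  have hgm := hgx m hm
  have hge : g x < g e := by
    by_contra! hle
    have hhull : convexHull ℝ (insert e Ω) ⊆ {z | g z ≤ g x} :=
      convexHull_min (insert_subset hle hgΩ) (convex_halfSpace_le g.toLinearMap.isLinear _)
    have habs : Absorbent ℝ ((fun v => m + v) ⁻¹' convexHull ℝ (insert e Ω)) :=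
      absorbent_nhds_zero (preimage_add_convexHull_insert_mem_nhds hm)
    obtain ⟨c, hc0, hc1, v, hv, hvx⟩ := exists_lt_of_gauge_lt habs hg
    have h1 : g (m + v) ≤ g x := hhull hv
    have h2 : c * g v = g x - g m := by
      rw [← map_sub, ← hvx]; simp
    rw [map_add] at h1
    nlinarith
  obtain ⟨hs1, hs2⟩ := hsteep g fun z hz => (hgΩ z hz).trans_lt hge
  refine le_lipEnvelope ⟨m, hmΩ⟩ fun z hz => ?_
  have hcoord := apply_eq_mul_add_mul hσ g
  have h := hgΩ z hz
  rw [hcoord z, hcoord x] at h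
  have h1 : g (0, 1) * (z.2 - x.2) ≥ -(k * -(σ * g (1, 0)) * |x.2 - z.2|) := by
    have h2 : |g (0, 1) * (z.2 - x.2)| ≤ k * -(σ * g (1, 0)) * |x.2 - z.2| := by
      rw [abs_mul, abs_sub_comm z.2]
      gcongr
    linarith [neg_abs_le (g (0, 1) * (z.2 - x.2))]
  have h2 : 0 ≤ (-(σ * g (1, 0))) * (σ * z.1 + k * |x.2 - z.2| - σ * x.1) := by
    nlinarith
  have h3 := nonneg_of_mul_nonneg_right h2 (by linarith)
  linarith

/-- Beyond a non-angular support line there is a point `e` at the height of an interior point such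
that every functional larger at `e` than on `Ω` is steep. -/
lemma exists_steep_vertex (hσ : σ = 1 ∨ σ = -1) (hconv : Convex ℝ Ω) (hint : (interior Ω).Nonempty)
    (hk : 0 < k) {P : ℝ × ℝ} (hP : P ∈ closure Ω) (hmin : ∀ z ∈ Ω, σ * P.1 ≤ σ * z.1)
    (hna : ∀ C > 0, ∃ z ∈ Ω, C * (σ * z.1 - σ * P.1) < |z.2 - P.2|) :
    ∃ m ∈ interior Ω, ∃ τ > 0, ∀ g : StrongDual ℝ (ℝ × ℝ),
      (∀ z ∈ Ω, g z < g (σ * (σ * P.1 - τ), m.2)) →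
        |g (0, 1)| ≤ k * -(σ * g (1, 0)) ∧ σ * g (1, 0) < 0 := by
  have hσσ : σ * σ = 1 := by rcases hσ with rfl | rfl <;> norm_num
  have hk' : (0 : ℝ) < k := hk
  obtain ⟨o, ho⟩ := hint
  obtain ⟨z, hz, hzC⟩ := hna (8 / k) (by positivity)
  set S := |z.2 - P.2| with hS
  have hD0 : 0 ≤ σ * z.1 - σ * P.1 := sub_nonneg.2 (hmin z hz)
  have hS0 : 0 < S := lt_of_le_of_lt (by positivity) hzC
  have hDS : σ * z.1 - σ * P.1 < k * S / 8 := by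
    rw [div_mul_eq_mul_div, div_lt_iff₀ hk'] at hzC
    linarith
  obtain ⟨m, hm, hm2⟩ : ∃ m ∈ interior Ω, |m.2 - (P.2 + z.2) / 2| ≤ S / 4 := by
    have hmid : (1 / 2 : ℝ) • P + (1 / 2 : ℝ) • z ∈ closure Ω :=
      hconv.closure hP (subset_closure hz) (by norm_num) (by norm_num) (by norm_num)
    set T := |o.2 - (P.2 + z.2) / 2| with hT
    have hT0 : 0 ≤ T := abs_nonneg _
    set t := S / (4 * (T + S)) with ht
    have ht0 : 0 < t := by positivity
    have ht1 : t ≤ 1 := by rw [ht, div_le_one (by positivity)]; linarith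
    refine ⟨_, hconv.combo_closure_interior_mem_interior hmid ho (sub_nonneg.2 ht1) ht0
      (by ring), ?_⟩
    have : ((1 - t) • ((1 / 2 : ℝ) • P + (1 / 2 : ℝ) • z) + t • o).2 - (P.2 + z.2) / 2
        = t * (o.2 - (P.2 + z.2) / 2) := by
      simp only [Prod.snd_add, Prod.smul_snd, smul_eq_mul]; ring
    rw [this, abs_mul, abs_of_pos ht0, ← hT, ht, div_mul_eq_mul_div,
      div_le_div_iff₀ (by positivity) (by norm_num)]
    nlinarith [mul_pos hS0 hS0]
  have hmΩ := interior_subset hm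
  have hmX := hmin m hmΩ
  refine ⟨m, hm, k * S / 8, by positivity, fun g hg => ?_⟩
  have hcoord := apply_eq_mul_add_mul hσ g
  have hge := hcoord (σ * (σ * P.1 - k * S / 8), m.2)
  have hgP : g P ≤ g (σ * (σ * P.1 - k * S / 8), m.2) :=
    closure_minimal (fun z hz => (hg z hz).le) (isClosed_le g.continuous continuous_const) hP
  have hgz := hg z hz
  have hgm := hg m hmΩ
  rw [hcoord P, hge] at hgP
  rw [hcoord z, hge] at hgz
  rw [hcoord m, hge] at hgm
  simp only [← mul_assoc σ σ, hσσ, one_mul] at hgP hgz hgm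
  have hτ0 : 0 < (k : ℝ) * S / 8 := by positivity
  generalize hτ : (k : ℝ) * S / 8 = τ at hτ0 hDS hgP hgz hgm
  generalize σ * P.1 = X₀ at *
  generalize σ * g (1, 0) = N at *
  generalize g (0, 1) = n at *
  clear hcoord hge hg hna hmin
  clear_value S
  have hN0 : N < 0 := by nlinarith
  refine ⟨?_, hN0⟩
  have hkey : |n| * (S / 4) ≤ -N * (2 * τ) := by
    have hz' : n * (z.2 - m.2) ≤ -N * (2 * τ) := by nlinarith
    have hP' : n * (P.2 - m.2) ≤ -N * (2 * τ) := by nlinarith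
    obtain ⟨h1, h2⟩ := abs_le.1 hm2
    have hor : (S / 4 ≤ z.2 - m.2 ∧ P.2 - m.2 ≤ -(S / 4)) ∨
        (S / 4 ≤ P.2 - m.2 ∧ z.2 - m.2 ≤ -(S / 4)) := by
      rcases abs_cases (z.2 - P.2) with ⟨h3, -⟩ | ⟨h3, -⟩
      · left; constructor <;> linarith
      · right; constructor <;> linarith
    rcases abs_cases n with ⟨h3, h4⟩ | ⟨h3, h4⟩ <;> rw [h3] <;>
      rcases hor with ⟨h5, h6⟩ | ⟨h5, h6⟩ <;> nlinarith
  have : |n| * (S / 4) ≤ k * -N * (S / 4) := by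
    refine hkey.trans_eq ?_
    rw [← hτ]; ring
  exact le_of_mul_le_mul_right this (by positivity)

/-- Near a non-angular support line, there is a concave barrier that is positive along a strip of
the graph of the Lipschitz envelope and vanishes on the rest of the boundary. -/
lemma exists_barrier (hσ : σ = 1 ∨ σ = -1) (hconv : Convex ℝ Ω) (hint : (interior Ω).Nonempty)
    (hk : 0 < k) {P : ℝ × ℝ} (hP : P ∈ closure Ω) (hmin : ∀ z ∈ Ω, σ * P.1 ≤ σ * z.1)
    (hna : ∀ C > 0, ∃ z ∈ Ω, C * (σ * z.1 - σ * P.1) < |z.2 - P.2|) :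
    ∃ (B : ℝ × ℝ → ℝ) (L : ℝ≥0), LipschitzWith L B ∧ ConcaveOn ℝ univ B ∧
      (∀ x ∈ Ω, 0 ≤ B x) ∧
      (∀ x : ℝ × ℝ, lipEnvelope Ω σ k x.2 < σ * x.1 → 0 < B x → x ∈ interior Ω) ∧
      ∃ β > 0, ∃ ρ > 0, ∃ δ > 0, ∃ y₀ : ℝ, ∀ x : ℝ × ℝ, |x.2 - y₀| < ρ →
        lipEnvelope Ω σ k x.2 < σ * x.1 → σ * x.1 < lipEnvelope Ω σ k x.2 + δ → β ≤ B x := by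
  have hσσ : σ * σ = 1 := by rcases hσ with rfl | rfl <;> norm_num
  obtain ⟨m, hm, τ, hτ0, hsteep⟩ := exists_steep_vertex hσ hconv hint hk hP hmin hna
  have hmΩ := interior_subset hm
  have hmX := hmin m hmΩ
  generalize σ * P.1 = X₀ at *
  generalize he : ((σ * (X₀ - τ), m.2) : ℝ × ℝ) = e at *
  set s : Set (ℝ × ℝ) := (fun v => m + v) ⁻¹' convexHull ℝ (insert e Ω) with hs
  have hΩs : ∀ x ∈ insert e Ω, x - m ∈ s := fun x hx => by
    simpa [hs] using subset_convexHull ℝ _ hx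
  have hsc : Convex ℝ s := (convex_convexHull ℝ _).translate_preimage_right m
  have hs0 : s ∈ nhds 0 := preimage_add_convexHull_insert_mem_nhds hm
  obtain ⟨L, hL⟩ := hsc.lipschitz_gauge hs0
  set B : ℝ × ℝ → ℝ := fun x => 1 - gauge s (x - m) with hB
  have hBl : LipschitzWith L B := by
    refine LipschitzWith.of_dist_le_mul fun x y => ?_
    have := hL.dist_le_mul (x - m) (y - m)
    simp only [hB, Real.dist_eq, sub_sub_sub_cancel_left]
    rw [abs_sub_comm]
    simpa [Real.dist_eq, dist_sub_right] using this
  have hBc : ConcaveOn ℝ univ B := by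
    refine ⟨convex_univ, fun x _ y _ a b ha hb hab => ?_⟩
    have hxy : a • x + b • y - m = a • (x - m) + b • (y - m) := by
      rw [smul_sub, smul_sub, sub_add_sub_comm, ← add_smul, hab, one_smul]
    have h := gauge_add_le hsc (absorbent_nhds_zero hs0) (a • (x - m)) (b • (y - m))
    rw [gauge_smul_of_nonneg ha, gauge_smul_of_nonneg hb] at h
    simp only [hB, hxy, smul_eq_mul] at h ⊢
    linarith
  refine ⟨B, L, hBl, hBc, fun x hx => sub_nonneg.2 (gauge_le_one_of_mem
    (hΩs x (mem_insert_of_mem _ hx))), fun x hx hxB => ?_, ?_⟩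
  · by_contra h
    exact hx.not_ge (le_lipEnvelope_of_separated hσ hconv hm hsteep h (sub_pos.1 hxB))
  have hcont := lipschitzWith_lipEnvelope (k := k) ⟨m, hmΩ⟩ hmin
  obtain ⟨r, hr, hrΩ⟩ := Metric.isOpen_iff.1 isOpen_interior m hm
  have hφm : lipEnvelope Ω σ k m.2 ≤ σ * m.1 - r / 2 := by
    have hmem : ((m.1 - σ * (r / 2), m.2) : ℝ × ℝ) ∈ Ω := by
      refine interior_subset (hrΩ ?_)
      have hσa : |σ| = 1 := by rcases hσ with rfl | rfl <;> norm_num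
      simp only [Metric.mem_ball, Prod.dist_eq, Real.dist_eq, dist_self]
      rw [sub_sub_cancel_left, abs_neg, abs_mul, hσa, one_mul, abs_of_pos (by linarith)]
      exact max_lt (by linarith) hr
    have h := lipEnvelope_le (k := k) hmin hmem m.2
    simp only [sub_self, abs_zero, mul_zero, add_zero] at h
    linear_combination h - (r / 2) * hσσ
  set θ := (σ * m.1 - X₀ + τ / 2) / (σ * m.1 - X₀ + τ) with hθ
  have hden : 0 < σ * m.1 - X₀ + τ := by linarith
  have hθ0 : 0 ≤ θ := div_nonneg (by linarith) hden.le
  have hθ1 : θ < 1 := by rw [hθ, div_lt_one hden]; linarith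
  have hθm : θ * (σ * m.1 - X₀ + τ) = σ * m.1 - X₀ + τ / 2 := div_mul_cancel₀ _ hden.ne'
  clear_value θ
  have hBe : 1 - θ ≤ B (σ * (X₀ - τ / 2), m.2) := by
    have heq : ((σ * (X₀ - τ / 2), m.2) : ℝ × ℝ) - m = θ • (e - m) := by
      ext
      · simp only [← he, Prod.fst_sub, Prod.smul_fst, smul_eq_mul]
        linear_combination σ * hθm + (1 - θ) * m.1 * hσσ
      · simp [← he]
    simp only [hB]
    rw [heq, gauge_smul_of_nonneg hθ0, smul_eq_mul]
    have := gauge_le_one_of_mem (hΩs e (mem_insert _ _))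
    nlinarith
  have hBm : B m = 1 := by simp [hB]
  have hev : ∀ᶠ y in nhds m.2, (1 - θ) / 2 < B (σ * (X₀ - τ / 2), y) ∧
      (1 - θ) / 2 < B (m.1, y) ∧ lipEnvelope Ω σ k y < σ * m.1 - r / 4 := by
    have h1 : Continuous fun y => B (σ * (X₀ - τ / 2), y) := hBl.continuous.comp (by fun_prop)
    have h2 : Continuous fun y => B (m.1, y) := hBl.continuous.comp (by fun_prop)
    exact ((h1.tendsto m.2).eventually_const_lt (by linarith)).and
      (((h2.tendsto m.2).eventually_const_lt (by rw [hBm]; linarith)).and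
        ((hcont.continuous.tendsto m.2).eventually_lt_const (by linarith)))
  obtain ⟨ρ, hρ, hball⟩ := Metric.eventually_nhds_iff_ball.1 hev
  refine ⟨(1 - θ) / 2, by linarith, ρ, hρ, r / 4, by linarith, m.2, fun x hx hx1 hx2 => ?_⟩
  obtain ⟨h1, h2, h3⟩ := hball x.2 (by simpa [Real.dist_eq] using hx)
  have hX : X₀ ≤ lipEnvelope Ω σ k x.2 := le_lipEnvelope ⟨m, hmΩ⟩ fun z hz => by
    have : 0 ≤ (k : ℝ) * |x.2 - z.2| := by positivity
    linarith [hmin z hz]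
  set d := σ * m.1 - (X₀ - τ / 2) with hd
  have hd0 : 0 < d := by linarith
  have hcomb := (hBc.convex_ge ((1 - θ) / 2)) ⟨mem_univ _, h1.le⟩ ⟨mem_univ _, h2.le⟩
    (a := (σ * m.1 - σ * x.1) / d) (b := (σ * x.1 - (X₀ - τ / 2)) / d)
    (div_nonneg (by linarith) hd0.le) (div_nonneg (by linarith) hd0.le)
    (by rw [← add_div, div_eq_one_iff_eq hd0.ne', hd]; ring)
  have hd1 : (σ * m.1 - σ * x.1) / d + (σ * x.1 - (X₀ - τ / 2)) / d = 1 := by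
    rw [← add_div, div_eq_one_iff_eq hd0.ne', hd]; ring
  have heq : x = ((σ * m.1 - σ * x.1) / d) • (σ * (X₀ - τ / 2), x.2) +
      ((σ * x.1 - (X₀ - τ / 2)) / d) • (m.1, x.2) := by
    ext
    · simp only [Prod.fst_add, Prod.smul_fst, smul_eq_mul]
      rw [div_mul_eq_mul_div, div_mul_eq_mul_div, ← add_div, eq_div_iff hd0.ne', hd]
      linear_combination (x.1 - m.1) * (X₀ - τ / 2) * hσσ
    · simp only [Prod.snd_add, Prod.smul_snd, smul_eq_mul]
      linear_combination (-x.2) * hd1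
  rw [heq]
  exact hcomb.2

end Envelope

section LocalMin

variable {Ω : Set (ℝ × ℝ)} {σ a b : ℝ}

lemma not_zeroIsLocalMin_of_not_angular (hconv : Convex ℝ Ω) (hbdd : Bornology.IsBounded Ω)
    (hint : (interior Ω).Nonempty) {f : ℝ × ℝ → ℝ} (hf : Continuous f) {α β : ℝ}
    (ha : 0 < a) (hb : 0 < b)
    (hTaylor : (fun ζ : ℝ × ℝ =>
        f ζ - (f 0 + α * ζ.1 + β * ζ.2 - a * ζ.1 ^ 2 + b * ζ.2 ^ 2))
        =o[nhds (0 : ℝ × ℝ)] fun ζ : ℝ × ℝ => ‖ζ‖ ^ 2)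
    (hσ : σ = 1 ∨ σ = -1) {P : ℝ × ℝ} (hP : P ∈ closure Ω)
    (hmin : ∀ z ∈ Ω, σ * P.1 ≤ σ * z.1) (hang : ¬ AngularSupportAt Ω P.1) :
    ¬ ZeroIsLocalMin Ω f := by
  have hne : Ω.Nonempty := hint.mono interior_subset
  have hna : ∀ C > 0, ∃ z ∈ Ω, C * (σ * z.1 - σ * P.1) < |z.2 - P.2| := fun C hC => by
    by_contra! h
    refine hang ⟨P.2, hP, C, hC, fun q hq => ?_⟩
    have hq1 : σ * q.1 - σ * P.1 = |q.1 - P.1| := by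
      rw [← abs_of_nonneg (sub_nonneg.2 (hmin q hq)), ← mul_sub, abs_mul]
      rcases hσ with rfl | rfl <;> simp
    exact hq1 ▸ h q hq
  set k : ℝ≥0 := ⟨√(a / (2 * b)), Real.sqrt_nonneg _⟩ with hkdef
  have hk0 : 0 < k := Real.sqrt_pos.2 (by positivity)
  have hk : b * k ^ 2 ≤ a / 2 := by
    have hsq : (k : ℝ) ^ 2 = a / (2 * b) := Real.sq_sqrt (by positivity)
    rw [hsq]
    apply le_of_eq
    field_simp
  obtain ⟨B, L, hBL, hBc, hB0, hBint, β', hβ', ρ, hρ, δ, hδ, y₀, hstrip⟩ :=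
    exists_barrier hσ hconv hint hk0 hP hmin hna
  obtain ⟨K, w, hw, hwc, hw0, hwz, hwpos⟩ := exists_energy_pos hconv hbdd ha hb hk hσ
    (lipschitzWith_lipEnvelope hne hmin) (convexOn_lipEnvelope hconv hne hmin) hBL hBc
    (fun x hx => ⟨by simpa using lipEnvelope_le (k := k) hmin hx x.2, hB0 x hx⟩)
    hBint hβ' hρ hδ hstrip
  exact not_zeroIsLocalMin_of_energy_pos hbdd hf hTaylor hw hwc hw0 hwz hwpos

end LocalMin

/-- If `f(ζ) = f(0) + αζ₁ + βζ₂ - aζ₁² + bζ₂² + o(|ζ|²)` with `a, b > 0`, and at least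
one vertical support line of `Ω` is not angular, then `u ≡ 0` is not a local minimum. -/
theorem stmt5 (Ω : Set (ℝ × ℝ)) (hconv : Convex ℝ Ω) (hbdd : Bornology.IsBounded Ω)
    (hint : (interior Ω).Nonempty) (f : ℝ × ℝ → ℝ) (hf : Continuous f)
    (α β a b : ℝ) (ha : 0 < a) (hb : 0 < b)
    (hTaylor : (fun ζ : ℝ × ℝ =>
        f ζ - (f 0 + α * ζ.1 + β * ζ.2 - a * ζ.1 ^ 2 + b * ζ.2 ^ 2))
        =o[nhds (0 : ℝ × ℝ)] fun ζ : ℝ × ℝ => ‖ζ‖ ^ 2)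
    (hang : ¬ AngularSupportAt Ω (leftX Ω) ∨ ¬ AngularSupportAt Ω (rightX Ω)) :
    ¬ ZeroIsLocalMin Ω f := by
  have hne : (Prod.fst '' Ω).Nonempty := (hint.mono interior_subset).image _
  have hbdd' : Bornology.IsBounded (Prod.fst '' Ω) := LipschitzWith.prod_fst.isBounded_image hbdd
  have hclosure : closure (Prod.fst '' Ω) ⊆ Prod.fst '' closure Ω :=
    closure_minimal (image_mono subset_closure)
      (hbdd.isCompact_closure.image continuous_fst).isClosed
  rcases hang with hang | hang
  · obtain ⟨P, hP, hPx⟩ := hclosure (csInf_mem_closure hne hbdd'.bddBelow)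
    refine not_zeroIsLocalMin_of_not_angular (σ := 1) hconv hbdd hint hf ha hb hTaylor
      (Or.inl rfl) hP (fun z hz => ?_) (hPx ▸ hang)
    have := csInf_le hbdd'.bddBelow (mem_image_of_mem Prod.fst hz)
    linarith
  · obtain ⟨P, hP, hPx⟩ := hclosure (csSup_mem_closure hne hbdd'.bddAbove)
    refine not_zeroIsLocalMin_of_not_angular (σ := -1) hconv hbdd hint hf ha hb hTaylor
      (Or.inr rfl) hP (fun z hz => ?_) (hPx ▸ hang)
    have := le_csSup hbdd'.bddAbove (mem_image_of_mem Prod.fst hz)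
    linarith
end

section
/- Let Ω ⊂ ℝ² be a convex bounded set with nonempty interior whose boundary ∂Ω contains at most one singular point (i.e., at most one point at which Ω admits more than one support line). Let f : ℝ² → ℝ be continuous and twice differentiable at (0,0) with f''(0,0) indefinite (one positive and one negative eigenvalue). Then the zero function u ≡ 0 is not a local minimum of the functional F(u) = ∫_Ω f(∇u(x,y)) dx dy on U_Ω with respect to the C¹ norm. -/
open MeasureTheory Real Set Filter Asymptotics

open scoped Topology NNReal Pointwise

/-- The Euclidean pairing with `n`, as a continuous linear functional. -/
noncomputable def dotL (n : ℝ × ℝ) : ℝ × ℝ →L[ℝ] ℝ :=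
  n.1 • ContinuousLinearMap.fst ℝ ℝ ℝ + n.2 • ContinuousLinearMap.snd ℝ ℝ ℝ

lemma dotL_apply (n q : ℝ × ℝ) : dotL n q = n.1 * q.1 + n.2 * q.2 := by
  simp [dotL]

lemma dotL_self_pos {n : ℝ × ℝ} (hn : n ≠ 0) : 0 < dotL n n := by
  rw [dotL_apply]
  by_contra h
  apply hn
  ext <;> simp <;> nlinarith [mul_self_nonneg n.1, mul_self_nonneg n.2]

lemma exists_eq_dotL (l : ℝ × ℝ →L[ℝ] ℝ) : ∃ m, l = dotL m := by
  refine ⟨(l (1, 0), l (0, 1)), ?_⟩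
  ext <;> simp [dotL_apply]

lemma isSupportDir_iff {Ω : Set (ℝ × ℝ)} {ξ n : ℝ × ℝ} :
    IsSupportDir Ω ξ n ↔ n ≠ 0 ∧ ∀ q ∈ Ω, dotL n q ≤ dotL n ξ := by
  simp [IsSupportDir, dotL_apply]

/-- A nonzero linear functional does not attain its supremum over a set in the interior. -/
lemma dotL_lt_of_mem_interior {Ω : Set (ℝ × ℝ)} {m : ℝ × ℝ} (hm : m ≠ 0) {a : ℝ}
    (h : ∀ q ∈ Ω, dotL m q ≤ a) {x : ℝ × ℝ} (hx : x ∈ interior Ω) : dotL m x < a := by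
  have hc : Tendsto (fun t : ℝ => x + t • m) (𝓝[>] 0) (𝓝 x) := by
    have : ContinuousAt (fun t : ℝ => x + t • m) 0 := by fun_prop
    simpa [ContinuousAt] using this.tendsto.mono_left nhdsWithin_le_nhds
  obtain ⟨t, ht, ht0⟩ :=
    ((hc.eventually (mem_interior_iff_mem_nhds.1 hx)).and self_mem_nhdsWithin).exists
  have h1 := h _ ht
  rw [map_add, map_smul, smul_eq_mul] at h1
  have := mul_pos ht0 (dotL_self_pos hm)
  linarith

lemma exists_mem_frontier_isSupportDir {Ω : Set (ℝ × ℝ)} (hbdd : Bornology.IsBounded Ω)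
    (hint : (interior Ω).Nonempty) {m : ℝ × ℝ} (hm : m ≠ 0) :
    ∃ ξ ∈ frontier Ω, IsSupportDir Ω ξ m := by
  obtain ⟨ξ, hξ, hmax⟩ := hbdd.isCompact_closure.exists_isMaxOn
    (hint.mono (interior_subset.trans subset_closure)) (dotL m).continuous.continuousOn
  refine ⟨ξ, ⟨hξ, fun hi => ?_⟩, isSupportDir_iff.2 ⟨hm, fun q hq => hmax (subset_closure hq)⟩⟩
  exact lt_irrefl _ (dotL_lt_of_mem_interior hm (fun q hq => hmax (subset_closure hq)) hi)

/-- If there is at most one singular point, every nonzero direction is, up to sign and length,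
normal to the unique support line at some boundary point. -/
lemma exists_regular_support {Ω : Set (ℝ × ℝ)} (hbdd : Bornology.IsBounded Ω)
    (hint : (interior Ω).Nonempty)
    (hsing : ∀ ξ₁ ξ₂ : ℝ × ℝ, IsSingularPoint Ω ξ₁ → IsSingularPoint Ω ξ₂ → ξ₁ = ξ₂)
    {w : ℝ × ℝ} (hw : w ≠ 0) :
    ∃ ξ n : ℝ × ℝ, ξ ∈ frontier Ω ∧ dotL n n = 1 ∧ (∃ r : ℝ, r ≠ 0 ∧ n = r • w) ∧
      IsSupportDir Ω ξ n ∧ ∀ m, IsSupportDir Ω ξ m → ∃ t : ℝ, m = t • n := by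
  have key : ∃ ξ n : ℝ × ℝ, ξ ∈ frontier Ω ∧ ¬ IsSingularPoint Ω ξ ∧
      (∃ r : ℝ, r ≠ 0 ∧ n = r • w) ∧ IsSupportDir Ω ξ n := by
    obtain ⟨ξ₁, h1, s1⟩ := exists_mem_frontier_isSupportDir hbdd hint hw
    obtain ⟨ξ₂, h2, s2⟩ := exists_mem_frontier_isSupportDir hbdd hint (neg_ne_zero.2 hw)
    by_cases hs1 : IsSingularPoint Ω ξ₁
    · by_cases hs2 : IsSingularPoint Ω ξ₂
      · exfalso
        obtain rfl := hsing _ _ hs1 hs2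
        obtain ⟨x, hx⟩ := hint
        have a1 := dotL_lt_of_mem_interior hw (isSupportDir_iff.1 s1).2 hx
        have a2 := (isSupportDir_iff.1 s2).2 x (interior_subset hx)
        simp only [dotL_apply, Prod.fst_neg, Prod.snd_neg] at a1 a2
        linarith
      · exact ⟨ξ₂, -w, h2, hs2, ⟨-1, by norm_num, by simp⟩, s2⟩
    · exact ⟨ξ₁, w, h1, hs1, ⟨1, by norm_num, by simp⟩, s1⟩
  obtain ⟨ξ, n, hξ, hns, ⟨r, hr, hnr⟩, hn⟩ := key
  have hpos := dotL_self_pos hn.1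
  set c := Real.sqrt (dotL n n) with hc
  have hc0 : 0 < c := Real.sqrt_pos.2 hpos
  have hcc : c * c = dotL n n := Real.mul_self_sqrt hpos.le
  have hn' : IsSupportDir Ω ξ (c⁻¹ • n) := by
    refine ⟨smul_ne_zero (inv_ne_zero hc0.ne') hn.1, fun q hq => ?_⟩
    have := mul_le_mul_of_nonneg_left (hn.2 q hq) (inv_pos.2 hc0).le
    simp only [Prod.smul_fst, Prod.smul_snd, smul_eq_mul]
    linarith
  refine ⟨ξ, c⁻¹ • n, hξ, ?_, ⟨c⁻¹ * r, mul_ne_zero (inv_ne_zero hc0.ne') hr, ?_⟩, hn', ?_⟩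
  · rw [dotL_apply] at hcc ⊢
    simp only [Prod.smul_fst, Prod.smul_snd, smul_eq_mul]
    field_simp
    linarith
  · rw [hnr, smul_smul]
  · intro m hm
    by_contra hcon
    exact hns ⟨hξ, _, m, hn', hm, hcon⟩

/-- At a boundary point with a unique support line, every direction pointing strictly into the
supporting half-plane points into the interior of the convex set. -/
lemma eventually_add_smul_mem_interior {Ω : Set (ℝ × ℝ)} (hconv : Convex ℝ Ω)
    (hint : (interior Ω).Nonempty) {ξ n : ℝ × ℝ} (hξ : ξ ∈ frontier Ω)
    (hn : IsSupportDir Ω ξ n) (hreg : ∀ m, IsSupportDir Ω ξ m → ∃ t : ℝ, m = t • n)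
    {d : ℝ × ℝ} (hd : dotL n d < 0) :
    ∀ᶠ t : ℝ in 𝓝[>] 0, ξ + t • d ∈ interior Ω := by
  have hex : ∃ t : ℝ, 0 < t ∧ ξ + t • d ∈ interior Ω := by
    by_contra! hcon
    have hconvray : Convex ℝ ((fun t : ℝ => ξ + t • d) '' Ioi 0) := by
      have := ((convex_Ioi (0 : ℝ)).is_linear_image
        (IsLinearMap.isLinearMap_smul' d)).translate ξ
      rwa [image_image] at this
    obtain ⟨l, a, hl1, hl2⟩ := geometric_hahn_banach_open hconv.interior isOpen_interior
      hconvray (by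
        rw [Set.disjoint_left]
        rintro _ hx ⟨t, ht, rfl⟩
        exact hcon t ht hx)
    have hclos : ∀ q ∈ closure Ω, l q ≤ a := by
      intro q hq
      rw [← hconv.closure_interior_eq_closure_of_nonempty_interior hint] at hq
      exact closure_minimal (fun x hx => (hl1 x hx).le)
        (isClosed_le l.continuous continuous_const) hq
    have hray : ∀ t : ℝ, 0 < t → a ≤ l ξ + t * l d := fun t ht => by
      simpa using hl2 _ ⟨t, ht, rfl⟩
    have hla : a ≤ l ξ := by
      have : Tendsto (fun t : ℝ => l ξ + t * l d) (𝓝[>] 0) (𝓝 (l ξ)) := by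
        have : ContinuousAt (fun t : ℝ => l ξ + t * l d) 0 := by fun_prop
        simpa [ContinuousAt] using this.tendsto.mono_left nhdsWithin_le_nhds
      exact ge_of_tendsto this (eventually_nhdsWithin_of_forall fun t ht => hray t ht)
    have hlξ : l ξ = a := le_antisymm (hclos ξ hξ.1) hla
    have hld : 0 ≤ l d := by have := hray 1 one_pos; linarith
    obtain ⟨x, hx⟩ := hint
    obtain ⟨m, rfl⟩ := exists_eq_dotL l
    have hm : IsSupportDir Ω ξ m := by
      refine isSupportDir_iff.2 ⟨?_, fun q hq => hlξ ▸ hclos q (subset_closure hq)⟩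
      rintro rfl
      have := hl1 x hx
      simp only [dotL_apply] at this hlξ
      simp at this hlξ
      linarith
    obtain ⟨t, rfl⟩ := hreg m hm
    have h1 := hl1 x hx
    have h2 := dotL_lt_of_mem_interior hn.1 (isSupportDir_iff.1 hn).2 hx
    have e : ∀ y, dotL (t • n) y = t * dotL n y := fun y => by simp [dotL_apply]; ring
    rw [e] at h1 hld hlξ
    have ht : t ≤ 0 := by by_contra! h; nlinarith
    nlinarith
  obtain ⟨T, hT, hTm⟩ := hex
  filter_upwards [Ioo_mem_nhdsGT hT] with t ht
  refine hconv.openSegment_closure_interior_subset_interior hξ.1 hTm ?_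
  refine ⟨1 - t / T, t / T, ?_, div_pos ht.1 hT, by ring, ?_⟩
  · rw [sub_pos, div_lt_one hT]; exact ht.2
  · ext <;> simp <;> field_simp <;> ring

/-- Vectors `g` with `g ⬝ (q - p) ≤ 1` on `Ω`, where `p` is close to a boundary point with unique
normal `n`, are either bounded or nearly parallel to `n`. -/
lemma exists_quadratic_bound {Ω : Set (ℝ × ℝ)} {ξ n : ℝ × ℝ} (hn1 : dotL n n = 1)
    (hreg : ∀ m, IsSupportDir Ω ξ m → ∃ t : ℝ, m = t • n)
    (B : ℝ × ℝ →L[ℝ] ℝ × ℝ →L[ℝ] ℝ) (hB : B n n < 0) :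
    ∃ A c r : ℝ, 0 ≤ A ∧ 0 < c ∧ 0 < r ∧ ∀ t ∈ Ioo 0 r, ∀ g : ℝ × ℝ,
      (∀ q ∈ Ω, dotL g (q - (ξ - t • n)) ≤ 1) → B g g ≤ A - c * ‖g‖ ^ 2 := by
  have hn0 : n ≠ 0 := by rintro rfl; simp [dotL_apply] at hn1
  have hnn : 0 < ‖n‖ := norm_pos_iff.2 hn0
  obtain ⟨c, hc, hcB⟩ : ∃ c : ℝ, 0 < c ∧ B n n = -2 * c * ‖n‖ ^ 2 :=
    ⟨-(B n n) / (2 * ‖n‖ ^ 2), div_pos (by linarith) (by positivity), by field_simp⟩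
  set Z : Set (ℝ × ℝ) := {ν | ‖ν‖ = 1 ∧ -c ≤ B ν ν} with hZ
  have hZc : IsCompact Z := by
    refine (isCompact_sphere (0 : ℝ × ℝ) 1).of_isClosed_subset ?_ (fun ν hν => by simpa using hν.1)
    exact (isClosed_eq continuous_norm continuous_const).inter
      (isClosed_le continuous_const
        ((B.continuous.clm_apply continuous_id : Continuous fun ν => B ν ν)))
  obtain ⟨k, hk⟩ : ∃ k : ℕ, ∀ ν ∈ Z, ∃ q ∈ Ω, 1 / ((k : ℝ) + 1) ≤ dotL ν (q - ξ) := by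
    by_contra! hcon
    choose ν hνZ hν using hcon
    obtain ⟨μ, hμ, φ, hφ, hlim⟩ := hZc.tendsto_subseq hνZ
    have hs : IsSupportDir Ω ξ μ := by
      refine isSupportDir_iff.2 ⟨by rintro rfl; simpa using hμ.1, fun q hq => ?_⟩
      have h1 : Tendsto (fun j => dotL (ν (φ j)) (q - ξ)) atTop (𝓝 (dotL μ (q - ξ))) := by
        have : Continuous fun m : ℝ × ℝ => dotL m (q - ξ) := by
          simp only [dotL_apply]; fun_prop
        exact (this.tendsto μ).comp hlim
      have h2 : Tendsto (fun j => 1 / ((φ j : ℝ) + 1)) atTop (𝓝 0) :=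
        tendsto_one_div_add_atTop_nhds_zero_nat.comp hφ.tendsto_atTop
      have h3 := le_of_tendsto_of_tendsto' h1 h2 fun j => (hν (φ j) q hq).le
      rw [map_sub] at h3
      linarith
    obtain ⟨t, rfl⟩ := hreg μ hs
    have h1 := hμ.2
    have h2 : |t| * ‖n‖ = 1 := by simpa [norm_smul] using hμ.1
    have h3 : t ^ 2 * ‖n‖ ^ 2 = 1 := by rw [← sq_abs, ← mul_pow, h2, one_pow]
    simp only [map_smul, smul_apply, smul_eq_mul, hcB] at h1
    nlinarith
  set η : ℝ := 1 / ((k : ℝ) + 1) with hη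
  have hη0 : 0 < η := by positivity
  set M : ℝ := 2 / η with hM
  have hM0 : 0 < M := by positivity
  refine ⟨(‖B‖ + c) * M ^ 2, c, η / 4, by positivity, hc, by positivity, fun t ht g hg => ?_⟩
  have hBg : B g g ≤ ‖B‖ * ‖g‖ ^ 2 := by
    have := (le_abs_self _).trans (B.le_opNorm₂ g g)
    nlinarith
  by_cases hgM : ‖g‖ ≤ M
  · have : ‖g‖ ^ 2 ≤ M ^ 2 := by gcongr
    nlinarith [norm_nonneg B]
  push Not at hgM
  have hg0 : 0 < ‖g‖ := hM0.trans hgM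
  set ν := ‖g‖⁻¹ • g with hν
  have hgν : g = ‖g‖ • ν := by rw [hν, smul_smul, mul_inv_cancel₀ hg0.ne', one_smul]
  have hν1 : ‖ν‖ = 1 := by rw [hν, norm_smul, norm_inv, norm_norm, inv_mul_cancel₀ hg0.ne']
  have hBν : B g g = ‖g‖ ^ 2 * B ν ν := by
    conv_lhs => rw [hgν]
    simp only [map_smul, smul_apply, smul_eq_mul]; ring
  by_cases hνZ : ν ∈ Z
  · exfalso
    obtain ⟨q, hq, hqη⟩ := hk ν hνZ
    have h1 := hg q hq
    have e : dotL g (q - (ξ - t • n)) = ‖g‖ * (dotL ν (q - ξ) + t * dotL ν n) := by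
      conv_lhs => rw [hgν]
      simp [dotL_apply]; ring
    have h2 : -2 ≤ dotL ν n := by
      rw [dotL_apply]
      have a1 : |ν.1| ≤ 1 := hν1 ▸ norm_fst_le ν
      have a2 : |ν.2| ≤ 1 := hν1 ▸ norm_snd_le ν
      rw [dotL_apply] at hn1
      have := abs_le.1 a1
      have := abs_le.1 a2
      nlinarith [sq_nonneg (ν.1 + n.1), sq_nonneg (ν.2 + n.2)]
    have h3 : η / 2 ≤ dotL ν (q - ξ) + t * dotL ν n := by nlinarith [ht.1, ht.2]
    have h4 : M * (η / 2) = 1 := by rw [hM]; field_simp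
    rw [e] at h1
    nlinarith
  · have : B ν ν < -c := by
      by_contra! h
      exact hνZ ⟨hν1, h⟩
    rw [hBν]
    have : 0 ≤ (‖B‖ + c) * M ^ 2 := by positivity
    nlinarith [sq_pos_of_pos hg0]

/-- The conical function over a convex set: it has height one at `p`, vanishes outside the set
and is affine on segments from `p` to the boundary. -/
lemma exists_cone {Ω : Set (ℝ × ℝ)} (hconv : Convex ℝ Ω) {p : ℝ × ℝ} (hp : p ∈ interior Ω) :
    ∃ (u : ℝ × ℝ → ℝ) (C : ℝ≥0), LipschitzWith C u ∧ (∀ x, 0 ≤ u x) ∧ (∀ x, u x ≤ 1) ∧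
      u p = 1 ∧ (∀ x, x ∉ Ω → u x = 0) ∧ (∀ x ∈ frontier Ω, u x = 0) ∧ ConcaveOn ℝ Ω u ∧
      (∀ q ∈ Ω, ∀ q' ∈ Ω, ∀ t : ℝ, 0 < t → u q - t ≤ u (q + t • (q' - p))) ∧
      ∀ (l : ℝ × ℝ →L[ℝ] ℝ) (c : ℝ), (∀ q ∈ Ω, l (q - p) ≤ c) →
        ∀ q ∈ Ω, l (q - p) ≤ c * (1 - u q) := by
  set s : Set (ℝ × ℝ) := (fun z => p + z) ⁻¹' Ω with hs
  have hmem : ∀ {x}, x ∈ Ω ↔ x - p ∈ s := by intro x; simp [hs]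
  have hsc : Convex ℝ s := hconv.translate_preimage_right p
  have hs0 : s ∈ 𝓝 (0 : ℝ × ℝ) := by
    apply (by fun_prop : Continuous fun z : ℝ × ℝ => p + z).continuousAt.preimage_mem_nhds
    simpa using mem_interior_iff_mem_nhds.1 hp
  have habs : Absorbent ℝ s := absorbent_nhds_zero hs0
  have h0s : (0 : ℝ × ℝ) ∈ s := mem_of_mem_nhds hs0
  obtain ⟨C, hC⟩ := hsc.lipschitz_gauge hs0
  have hout : ∀ x, x ∉ Ω → 1 ≤ gauge s (x - p) := fun x hx =>
    one_le_gauge_of_notMem (hsc.starConvex h0s) habs.absorbs (fun h => hx (hmem.2 h))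
  have hin : ∀ x ∈ Ω, gauge s (x - p) ≤ 1 := fun x hx => gauge_le_one_of_mem (hmem.1 hx)
  have heq : ∀ x ∈ Ω, max 0 (1 - gauge s (x - p)) = 1 - gauge s (x - p) := fun x hx =>
    max_eq_right (by linarith [hin x hx])
  refine ⟨fun x => max 0 (1 - gauge s (x - p)), C, ?_, fun x => le_max_left _ _, fun x => ?_, ?_,
    fun x hx => max_eq_left (by linarith [hout x hx]), fun x hx => ?_, ?_, ?_, ?_⟩
  · have h1 : LipschitzWith C fun x => 1 - gauge s (x - p) := by
      refine LipschitzWith.of_dist_le_mul fun x y => ?_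
      have := hC.dist_le_mul (x - p) (y - p)
      rw [dist_sub_right] at this
      rwa [dist_sub_left]
    exact h1.const_max 0
  · exact max_le zero_le_one (by linarith [gauge_nonneg (s := s) (x - p)])
  · simp
  · refine max_eq_left ?_
    have : 1 ≤ gauge s (x - p) := by
      by_contra! h
      have h1 := (gauge_lt_one_iff_mem_interior hsc hs0).1 h
      have h2 : interior s = (fun z => p + z) ⁻¹' interior Ω :=
        ((Homeomorph.addLeft p).preimage_interior Ω).symm
      rw [h2] at h1
      simp only [mem_preimage, add_sub_cancel] at h1
      exact hx.2 h1
    linarith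
  · refine ⟨hconv, fun x hx y hy a b ha hb hab => ?_⟩
    simp only [smul_eq_mul]
    rw [heq x hx, heq y hy, heq _ (hconv hx hy ha hb hab)]
    have e : a • x + b • y - p = a • (x - p) + b • (y - p) := by
      have : p = (a + b) • p := by rw [hab, one_smul]
      conv_lhs => rw [this]
      module
    have h := gauge_add_le hsc habs (a • (x - p)) (b • (y - p))
    rw [gauge_smul_of_nonneg ha, gauge_smul_of_nonneg hb, ← e] at h
    simp only [smul_eq_mul] at h
    nlinarith
  · intro q hq q' hq' t ht
    simp only
    rw [heq q hq]
    refine le_trans ?_ (le_max_right _ _)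
    have h := gauge_add_le hsc habs (q - p) (t • (q' - p))
    rw [gauge_smul_of_nonneg ht.le, smul_eq_mul] at h
    have e : q + t • (q' - p) - p = q - p + t • (q' - p) := by module
    rw [e]
    nlinarith [hin q' hq']
  · intro l c hl q hq
    simp only
    rw [heq q hq]
    have hc : 0 ≤ c := by simpa using hl p (interior_subset hp)
    have key : ∀ r, gauge s (q - p) < r → l (q - p) ≤ c * r := by
      intro r hr
      obtain ⟨b, hb0, hbr, z, hz, hzq⟩ := exists_lt_of_gauge_lt habs hr
      have h1 : l z ≤ c := by simpa using hl (p + z) hz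
      simp only at hzq
      rw [← hzq, map_smul, smul_eq_mul]
      nlinarith
    have : Tendsto (fun r => c * r) (𝓝[>] (gauge s (q - p))) (𝓝 (c * gauge s (q - p))) :=
      ((continuous_const.mul continuous_id).tendsto _).mono_left nhdsWithin_le_nhds
    simpa using ge_of_tendsto this (eventually_nhdsWithin_of_forall fun r hr => key r hr)

/-- A one-sided linear lower bound for increments passes to the derivative. -/
lemma le_fderiv_of_forall_le {u : ℝ × ℝ → ℝ} {q z : ℝ × ℝ} {a : ℝ} (hu : DifferentiableAt ℝ u q)
    (h : ∀ t ∈ Ioo (0 : ℝ) 1, u q + t * a ≤ u (q + t • z)) : a ≤ fderiv ℝ u q z := by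
  have h1 := (hu.hasFDerivAt.hasLineDerivAt z).tendsto_slope_zero_right
  refine ge_of_tendsto h1 ?_
  filter_upwards [Ioo_mem_nhdsGT one_pos] with t ht
  rw [smul_eq_mul, inv_mul_eq_div, le_div_iff₀ ht.1]
  have := h t ht
  simp
  linarith

lemma fderiv_eq_dotL (u : ℝ × ℝ → ℝ) (q : ℝ × ℝ) : fderiv ℝ u q = dotL (uX u q, uY u q) := by
  ext <;> simp [dotL_apply, uX, uY]

lemma norm_gradient_le {u : ℝ × ℝ → ℝ} {C : ℝ≥0} (hu : LipschitzWith C u) (q : ℝ × ℝ) :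
    ‖(uX u q, uY u q)‖ ≤ C := by
  have h := norm_fderiv_le_of_lipschitz ℝ (x₀ := q) hu
  have e1 : ‖((1 : ℝ), (0 : ℝ))‖ = 1 := by simp [Prod.norm_def]
  have e2 : ‖((0 : ℝ), (1 : ℝ))‖ = 1 := by simp [Prod.norm_def]
  refine norm_prod_le_iff.2 ⟨?_, ?_⟩
  · simpa [e1, uX] using (fderiv ℝ u q).le_of_opNorm_le h (1, 0)
  · simpa [e2, uY] using (fderiv ℝ u q).le_of_opNorm_le h (0, 1)

lemma measurable_gradient (u : ℝ × ℝ → ℝ) : Measurable fun q => (uX u q, uY u q) :=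
  (measurable_fderiv_apply_const ℝ u (1, 0)).prodMk (measurable_fderiv_apply_const ℝ u (0, 1))

lemma integrableOn_comp_gradient {Ω : Set (ℝ × ℝ)} (hbdd : Bornology.IsBounded Ω)
    {h : ℝ × ℝ → ℝ} (hh : Continuous h) {u : ℝ × ℝ → ℝ} {C : ℝ≥0} (hu : LipschitzWith C u) :
    IntegrableOn (fun q => h (uX u q, uY u q)) Ω := by
  obtain ⟨M, hM⟩ := (isCompact_closedBall (0 : ℝ × ℝ) C).exists_bound_of_continuousOn
    hh.continuousOn
  refine Measure.integrableOn_of_bounded (M := M) hbdd.measure_lt_top.ne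
    (hh.measurable.comp (measurable_gradient u)).aestronglyMeasurable
    (Eventually.of_forall fun q => hM _ ?_)
  simpa using norm_gradient_le hu q

lemma gradient_eq_zero {u : ℝ × ℝ → ℝ} (h0 : ∀ x, 0 ≤ u x) {q : ℝ × ℝ} (hq : u q = 0) :
    (uX u q, uY u q) = 0 := by
  have : fderiv ℝ u q = 0 :=
    IsLocalMin.fderiv_eq_zero (Eventually.of_forall fun x => hq ▸ h0 x)
  simp [uX, uY, this]

/-- The area of a rectangle in the orthonormal frame `(-n, (-n₂, n₁))`, scaled by `δ`. -/
lemma volume_image_frame {n : ℝ × ℝ} (hn1 : dotL n n = 1) (ξ : ℝ × ℝ) {δ : ℝ}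
    {a b K : ℝ} (hab : a ≤ b) (hK : 0 ≤ K) :
    volume.real ((fun z : ℝ × ℝ => ξ + δ • (z.1 • (-n) + z.2 • (-n.2, n.1))) ''
      (Icc a b ×ˢ Icc (-K) K)) = δ ^ 2 * ((b - a) * (2 * K)) := by
  set T : ℝ × ℝ →ₗ[ℝ] ℝ × ℝ := Matrix.toLin (Module.Basis.finTwoProd ℝ) (Module.Basis.finTwoProd ℝ)
    !![-(δ * n.1), -(δ * n.2); -(δ * n.2), δ * n.1] with hT
  have hdet : |LinearMap.det T| = δ ^ 2 := by
    rw [hT, LinearMap.det_toLin, Matrix.det_fin_two_of]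
    rw [dotL_apply] at hn1
    have : -(δ * n.1) * (δ * n.1) - -(δ * n.2) * -(δ * n.2) = -δ ^ 2 := by
      linear_combination (-δ ^ 2) * hn1
    rw [this, abs_neg, abs_of_nonneg (sq_nonneg δ)]
  have himg : (fun z : ℝ × ℝ => ξ + δ • (z.1 • (-n) + z.2 • (-n.2, n.1))) ''
      (Icc a b ×ˢ Icc (-K) K) = (fun x => ξ + x) '' (T '' (Icc a b ×ˢ Icc (-K) K)) := by
    rw [image_image]
    refine image_congr fun z _ => ?_
    rw [hT, Matrix.toLin_finTwoProd_apply]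
    ext <;> simp <;> ring
  rw [himg, measureReal_def, Set.image_add_left, measure_preimage_add,
    Measure.addHaar_image_linearMap, hdet, Measure.volume_eq_prod, Measure.prod_prod,
    Real.volume_Icc, Real.volume_Icc, ENNReal.toReal_mul, ENNReal.toReal_mul,
    ENNReal.toReal_ofReal (sq_nonneg δ), ENNReal.toReal_ofReal (by linarith),
    ENNReal.toReal_ofReal (by linarith)]
  ring

/-- Near a boundary point with unique support line, conical functions with apex close to that point
have arbitrarily large Dirichlet energy, concentrated in the normal direction. -/
lemma exists_neg_energy {Ω : Set (ℝ × ℝ)} (hconv : Convex ℝ Ω) (hbdd : Bornology.IsBounded Ω)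
    (hint : (interior Ω).Nonempty)
    {ξ n : ℝ × ℝ} (hξ : ξ ∈ frontier Ω) (hn1 : dotL n n = 1)
    (hn : IsSupportDir Ω ξ n) (hreg : ∀ m, IsSupportDir Ω ξ m → ∃ t : ℝ, m = t • n)
    (B : ℝ × ℝ →L[ℝ] ℝ × ℝ →L[ℝ] ℝ) (hB : B n n < 0) :
    ∃ (u : ℝ × ℝ → ℝ) (C : ℝ≥0), LipschitzWith C u ∧ (∀ x, 0 ≤ u x) ∧ (∀ x, u x ≤ 1) ∧
      (∀ x, x ∉ Ω → u x = 0) ∧ (∀ x ∈ frontier Ω, u x = 0) ∧ ConcaveOn ℝ Ω u ∧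
      ∫ q in Ω, B (uX u q, uY u q) (uX u q, uY u q) < 0 := by
  obtain ⟨A, c, r, hA, hc, hr, hquad⟩ := exists_quadratic_bound hn1 hreg B hB
  set V := volume.real Ω with hV
  have hV0 : 0 ≤ V := measureReal_nonneg
  set K : ℝ := 64 * (A * V + 1) / c with hK
  have hK0 : 0 < K := by positivity
  set τ : ℝ × ℝ := (-n.2, n.1) with hτ
  have hnτ : dotL n τ = 0 := by simp [dotL_apply, hτ]; ring
  have hdir : ∀ k : ℝ, ∀ᶠ t : ℝ in 𝓝[>] 0, ξ + t • (-n + k • τ) ∈ interior Ω := fun k =>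
    eventually_add_smul_mem_interior hconv hint hξ hn hreg (by simp [hnτ, hn1])
  obtain ⟨δ, ⟨⟨hδ, hp⟩, hm⟩, hδr⟩ :=
    (((hdir (8 * K)).and (hdir 0)).and (hdir (-(8 * K)))).and (Ioo_mem_nhdsGT hr) |>.exists
  have hδ0 : 0 < δ := hδr.1
  set p : ℝ × ℝ := ξ - δ • n with hpdef
  have hp : p ∈ interior Ω := by convert hp using 1; rw [hpdef]; module
  set P : ℝ → ℝ → ℝ × ℝ := fun s y => ξ + δ • (s • (-n) + y • τ) with hP
  have hmem1 : ∀ y, |y| ≤ 8 * K → P 1 y ∈ interior Ω := by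
    intro y hy
    have hy' := abs_le.1 hy
    have := hconv.interior hδ hm (a := (1 + y / (8 * K)) / 2) (b := (1 - y / (8 * K)) / 2)
      (by have : -1 ≤ y / (8 * K) := by rw [le_div_iff₀ (by positivity)]; linarith
          linarith)
      (by have : y / (8 * K) ≤ 1 := by rw [div_le_one (by positivity)]; linarith
          linarith) (by ring)
    convert this using 1
    have e : y = (y / (8 * K)) * (8 * K) := by field_simp
    simp only [hP]
    conv_lhs => rw [e]
    module
  have hmem : ∀ s y, 1 / 8 ≤ s → s < 1 → |y| ≤ K → P s y ∈ interior Ω := by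
    intro s y hs hs1 hy
    have hs0 : 0 < s := by linarith
    refine hconv.openSegment_closure_interior_subset_interior hξ.1 (hmem1 (y / s) ?_) ?_
    · rw [abs_div, abs_of_pos hs0, div_le_iff₀ hs0]; nlinarith
    · refine ⟨1 - s, s, by linarith, hs0, by ring, ?_⟩
      have e : y = s * (y / s) := by field_simp
      simp only [hP]
      conv_rhs => rw [e]
      module
  obtain ⟨u, C, hLip, hu0, hu1, hup, huout, hufr, hconc, hcone, hlin⟩ := exists_cone hconv hp
  refine ⟨u, C, hLip, hu0, hu1, huout, hufr, hconc, ?_⟩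
  set R := (fun z : ℝ × ℝ => ξ + δ • (z.1 • (-n) + z.2 • (-n.2, n.1))) ''
      (Icc (1 / 8) (1 / 4) ×ˢ Icc (-K) K) with hR
  have hRΩ : R ⊆ Ω := by
    rintro _ ⟨⟨s, y⟩, ⟨hs, hy⟩, rfl⟩
    exact interior_subset (hmem s y hs.1 (by linarith [hs.2]) (abs_le.2 hy))
  have hRm : MeasurableSet R :=
    ((isCompact_Icc.prod isCompact_Icc).image (by fun_prop)).measurableSet
  have hRv : volume.real R = δ ^ 2 * ((1 / 4 - 1 / 8) * (2 * K)) :=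
    volume_image_frame hn1 ξ (by norm_num) hK0.le
  have hpolar : ∀ q ∈ Ω, DifferentiableAt ℝ u q →
      B (uX u q, uY u q) (uX u q, uY u q) ≤ A - c * ‖(uX u q, uY u q)‖ ^ 2 := by
    intro q hq hd
    have := hquad δ hδr (-(uX u q, uY u q)) (fun q' hq' => ?_)
    · simpa only [map_neg, neg_apply, neg_neg, norm_neg] using this
    · have h := le_fderiv_of_forall_le (z := q' - p) (a := -1) hd fun t ht => by
        have := hcone q hq q' hq' t ht.1
        linarith
      rw [fderiv_eq_dotL, dotL_apply] at h
      rw [dotL_apply]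
      simp only [Prod.fst_neg, Prod.snd_neg]
      linarith
  have hsteep : ∀ q ∈ R, DifferentiableAt ℝ u q →
      1 / (16 * δ ^ 2) ≤ ‖(uX u q, uY u q)‖ ^ 2 := by
    rintro _ ⟨⟨s, y⟩, ⟨hs, hy⟩, rfl⟩ hd
    change DifferentiableAt ℝ u (P s y) at hd
    change 1 / (16 * δ ^ 2) ≤ ‖(uX u (P s y), uY u (P s y))‖ ^ 2
    simp only at hs hy
    have hyK : |y| ≤ K := abs_le.2 hy
    have hq : P s y ∈ Ω := interior_subset (hmem s y hs.1 (by linarith [hs.2]) hyK)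
    have hq' : P 1 y ∈ Ω := interior_subset (hmem1 y (by linarith))
    have hup1 : 7 / 8 ≤ u (P 1 y) := by
      have hfar : P 1 (8 * y) ∈ Ω :=
        interior_subset (hmem1 (8 * y) (by rw [abs_mul, abs_of_pos] <;> linarith))
      have h := hconc.2 (interior_subset hp) hfar (by norm_num : (0 : ℝ) ≤ 7 / 8)
        (by norm_num : (0 : ℝ) ≤ 1 / 8) (by norm_num)
      have e : (7 / 8 : ℝ) • p + (1 / 8 : ℝ) • P 1 (8 * y) = P 1 y := by
        rw [hpdef]; simp only [hP]; module
      rw [e, hup] at h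
      simp only [smul_eq_mul] at h
      linarith [hu0 (P 1 (8 * y))]
    have hulow : u (P s y) ≤ 1 / 4 := by
      have h := hlin (dotL n) δ (fun q hq => by
        have := (isSupportDir_iff.1 hn).2 q hq
        rw [hpdef, map_sub, map_sub, map_smul, hn1, smul_eq_mul]
        linarith) _ hq
      have e : dotL n (P s y - p) = δ * (1 - s) := by
        rw [hpdef]
        simp only [hP, map_sub, map_add, map_smul, map_neg, hn1, hnτ, smul_eq_mul]
        ring
      rw [e] at h
      have := le_of_mul_le_mul_left h hδ0
      linarith [hs.2]
    have h := le_fderiv_of_forall_le (z := P 1 y - P s y) (a := u (P 1 y) - u (P s y)) hd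
      fun t ht => by
        have h := hconc.2 hq hq' (sub_nonneg.2 ht.2.le) ht.1.le (by ring)
        have e : (1 - t) • P s y + t • P 1 y = P s y + t • (P 1 y - P s y) := by module
        rw [e] at h
        simp only [smul_eq_mul] at h
        linarith
    have e : P 1 y - P s y = (-(δ * (1 - s))) • n := by simp only [hP]; module
    rw [e, fderiv_eq_dotL, map_smul, smul_eq_mul] at h
    set g := (uX u (P s y), uY u (P s y)) with hg
    have hgn : |dotL g n| ≤ 2 * ‖g‖ := by
      rw [dotL_apply] at hn1 ⊢
      have a1 : |g.1| ≤ ‖g‖ := norm_fst_le g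
      have a2 : |g.2| ≤ ‖g‖ := norm_snd_le g
      have b1 : |n.1| ≤ 1 := abs_le_one_iff_mul_self_le_one.2 (by nlinarith [mul_self_nonneg n.2])
      have b2 : |n.2| ≤ 1 := abs_le_one_iff_mul_self_le_one.2 (by nlinarith [mul_self_nonneg n.1])
      have h1 := abs_add_le (g.1 * n.1) (g.2 * n.2)
      rw [abs_mul, abs_mul] at h1
      nlinarith [abs_nonneg g.1, abs_nonneg g.2]
    have h2 : 1 / 2 ≤ δ * (2 * ‖g‖) := by
      have a1 : -(dotL g n) ≤ 2 * ‖g‖ := (neg_le_abs _).trans hgn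
      have a2 : 0 ≤ δ * (1 - s) := mul_nonneg hδ0.le (by linarith [hs.2])
      have a3 : δ * (1 - s) ≤ δ := by nlinarith [hs.1]
      have a4 := mul_le_mul_of_nonneg_left a1 a2
      have a5 := mul_le_mul_of_nonneg_right a3 (by positivity : 0 ≤ 2 * ‖g‖)
      linarith
    rw [div_le_iff₀ (by positivity)]
    nlinarith [mul_nonneg hδ0.le (norm_nonneg g)]
  have hle : ∀ᵐ q, B (uX u q, uY u q) (uX u q, uY u q) ≤
      A - R.indicator (fun _ => c / (16 * δ ^ 2)) q := by
    filter_upwards [hLip.ae_differentiableAt] with q hd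
    by_cases hqR : q ∈ R
    · rw [indicator_of_mem hqR]
      have h1 := hpolar q (hRΩ hqR) hd
      have h2 := mul_le_mul_of_nonneg_left (hsteep q hqR hd) hc.le
      rw [mul_one_div] at h2
      linarith
    · rw [indicator_of_notMem hqR]
      by_cases hq : q ∈ Ω
      · have := hpolar q hq hd
        nlinarith [sq_nonneg ‖(uX u q, uY u q)‖]
      · rw [gradient_eq_zero hu0 (huout q hq)]
        simpa using hA
  have hconst : ∀ a : ℝ, IntegrableOn (fun _ : ℝ × ℝ => a) Ω := fun a =>
    integrableOn_const hbdd.measure_lt_top.ne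
  have hind : IntegrableOn (R.indicator fun _ => c / (16 * δ ^ 2)) Ω := (hconst _).indicator hRm
  calc ∫ q in Ω, B (uX u q, uY u q) (uX u q, uY u q)
      ≤ ∫ q in Ω, (A - R.indicator (fun _ => c / (16 * δ ^ 2)) q) :=
        integral_mono_ae (integrableOn_comp_gradient hbdd
          (B.continuous.clm_apply continuous_id : Continuous fun ν => B ν ν) hLip)
          ((hconst A).sub hind) (ae_restrict_of_ae hle)
    _ = V * A - volume.real R * (c / (16 * δ ^ 2)) := by
        rw [integral_sub (hconst A) hind, setIntegral_indicator hRm, inter_eq_right.2 hRΩ,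
          setIntegral_const, setIntegral_const, smul_eq_mul, smul_eq_mul]
    _ < 0 := by
        have e : volume.real R * (c / (16 * δ ^ 2)) = A * V + 1 := by
          rw [hRv, hK]; field_simp; norm_num
        rw [e]; linarith

lemma gradient_const_mul (u : ℝ × ℝ → ℝ) (ε : ℝ) (q : ℝ × ℝ) :
    (uX (fun x => ε * u x) q, uY (fun x => ε * u x) q) = ε • (uX u q, uY u q) := by
  have h : fderiv ℝ (fun x => ε * u x) q = ε • fderiv ℝ u q :=
    congrFun (fderiv_const_smul_field (f := u) ε) q
  simp [uX, uY, h]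

/-- The directional derivatives of a Lipschitz function vanishing outside a bounded set have zero
integral. -/
lemma integral_fderiv_apply_eq_zero {Ω : Set (ℝ × ℝ)} (hbdd : Bornology.IsBounded Ω)
    {u : ℝ × ℝ → ℝ} {C : ℝ≥0} (hu : LipschitzWith C u) (h0 : ∀ x, 0 ≤ u x)
    (hout : ∀ x, x ∉ Ω → u x = 0) (v : ℝ × ℝ) : ∫ q in Ω, fderiv ℝ u q v = 0 := by
  have hsupp : HasCompactSupport u :=
    HasCompactSupport.intro hbdd.isCompact_closure fun x hx => hout x fun h => hx (subset_closure h)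
  have hzero : ∀ q, q ∉ Ω → fderiv ℝ u q v = 0 := fun q hq => by
    have h := gradient_eq_zero h0 (hout q hq)
    rw [fderiv_eq_dotL, h]
    simp [dotL_apply]
  rw [setIntegral_eq_integral_of_forall_compl_eq_zero hzero]
  have h := (LipschitzWith.const (1 : ℝ)).integral_lineDeriv_mul_eq (μ := volume) hu hsupp (-v)
  simp only [neg_neg, mul_one] at h
  rw [← integral_congr_ae (hu.ae_differentiableAt.mono fun q hq => hq.lineDeriv_eq_fderiv), ← h]
  simp [lineDeriv]

lemma memU_const_mul {Ω : Set (ℝ × ℝ)} {u : ℝ × ℝ → ℝ} {C : ℝ≥0} (hu : LipschitzWith C u)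
    (hfr : ∀ x ∈ frontier Ω, u x = 0) (hconc : ConcaveOn ℝ Ω u) {ε : ℝ} (hε : 0 ≤ ε) :
    MemU Ω fun x => ε * u x := by
  refine ⟨(hu.continuous.const_mul ε).continuousOn, hconc.smul hε,
    ae_restrict_of_ae (hu.ae_differentiableAt.mono fun q hq => hq.const_mul ε),
    ⟨ε * C, fun q _ _ => ?_⟩, fun x hx => by simp [hfr x hx]⟩
  have h : fderiv ℝ (fun x => ε * u x) q = ε • fderiv ℝ u q :=
    congrFun (fderiv_const_smul_field (f := u) ε) q
  rw [h, norm_smul, Real.norm_of_nonneg hε]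
  exact mul_le_mul_of_nonneg_left (norm_fderiv_le_of_lipschitz ℝ hu) hε

lemma c1Norm_const_mul_le {Ω : Set (ℝ × ℝ)} {u : ℝ × ℝ → ℝ} {C : ℝ≥0} (hu : LipschitzWith C u)
    (h0 : ∀ x, 0 ≤ u x) (h1 : ∀ x, u x ≤ 1) {ε : ℝ} (hε : 0 ≤ ε) :
    C1Norm Ω (fun x => ε * u x) ≤ ε * (1 + 2 * C) := by
  have hg : ∀ q, ‖(uX (fun x => ε * u x) q, uY (fun x => ε * u x) q)‖ ≤ ε * C := fun q => by
    rw [gradient_const_mul, norm_smul, Real.norm_of_nonneg hε]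
    exact mul_le_mul_of_nonneg_left (norm_gradient_le hu q) hε
  have a1 : sSup ((fun p => |ε * u p|) '' Ω) ≤ ε := by
    refine Real.sSup_le ?_ hε
    rintro _ ⟨q, -, rfl⟩
    simp only
    rw [abs_of_nonneg (mul_nonneg hε (h0 q))]
    exact mul_le_of_le_one_right hε (h1 q)
  have a2 : sSup ((fun p => |uX (fun x => ε * u x) p|) ''
      {p ∈ Ω | DifferentiableAt ℝ (fun x => ε * u x) p}) ≤ ε * C := by
    refine Real.sSup_le ?_ (by positivity)
    rintro _ ⟨q, -, rfl⟩
    exact (norm_fst_le _).trans (hg q)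
  have a3 : sSup ((fun p => |uY (fun x => ε * u x) p|) ''
      {p ∈ Ω | DifferentiableAt ℝ (fun x => ε * u x) p}) ≤ ε * C := by
    refine Real.sSup_le ?_ (by positivity)
    rintro _ ⟨q, -, rfl⟩
    exact (norm_snd_le _).trans (hg q)
  unfold C1Norm
  linarith

/-- If the second variation of the functional at zero is negative on some admissible function, then
zero is not a local minimum. -/
lemma not_zeroIsLocalMin_of_neg_energy {Ω : Set (ℝ × ℝ)} (hbdd : Bornology.IsBounded Ω)
    {f : ℝ × ℝ → ℝ} (hf : Continuous f)
    {L : ℝ × ℝ →L[ℝ] ℝ} {B : ℝ × ℝ →L[ℝ] ℝ × ℝ →L[ℝ] ℝ}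
    (hTaylor : (fun ζ : ℝ × ℝ => f ζ - f 0 - L ζ - (1 / 2) * B ζ ζ)
        =o[nhds (0 : ℝ × ℝ)] fun ζ : ℝ × ℝ => ‖ζ‖ ^ 2)
    {u : ℝ × ℝ → ℝ} {C : ℝ≥0} (hu : LipschitzWith C u) (h0 : ∀ x, 0 ≤ u x) (h1 : ∀ x, u x ≤ 1)
    (hout : ∀ x, x ∉ Ω → u x = 0) (hfr : ∀ x ∈ frontier Ω, u x = 0) (hconc : ConcaveOn ℝ Ω u)
    (hneg : ∫ q in Ω, B (uX u q, uY u q) (uX u q, uY u q) < 0) : ¬ ZeroIsLocalMin Ω f := by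
  rintro ⟨δ, hδ, hmin⟩
  set I := ∫ q in Ω, B (uX u q, uY u q) (uX u q, uY u q) with hI
  set V := volume.real Ω with hV
  have hV0 : 0 ≤ V := measureReal_nonneg
  set κ : ℝ := -I / (4 * (C ^ 2 * V + 1)) with hκ
  have hκ0 : 0 < κ := div_pos (by linarith) (by positivity)
  have hκI : κ * (C ^ 2 * V) ≤ -I / 4 := by
    have : κ * (C ^ 2 * V + 1) = -I / 4 := by rw [hκ]; field_simp
    linarith
  obtain ⟨ρ, hρ, hρT⟩ := Metric.eventually_nhds_iff.1 (hTaylor.bound hκ0)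
  obtain ⟨ε, hε0, hεδ, hερ⟩ : ∃ ε : ℝ, 0 < ε ∧ ε * (1 + 2 * C) < δ ∧ ε * C < ρ := by
    have t1 : ∀ a : ℝ, Tendsto (fun ε : ℝ => ε * a) (𝓝[>] 0) (𝓝 0) := fun a => by
      have : ContinuousAt (fun ε : ℝ => ε * a) 0 := by fun_prop
      simpa [ContinuousAt] using this.tendsto.mono_left nhdsWithin_le_nhds
    obtain ⟨ε, ⟨ha, hb⟩, hc⟩ := ((((t1 (1 + 2 * C)).eventually_lt_const hδ).and
      ((t1 C).eventually_lt_const hρ)).and self_mem_nhdsWithin).exists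
    exact ⟨ε, hc, ha, hb⟩
  have hF := hmin _ (memU_const_mul hu hfr hconc hε0.le)
    ((c1Norm_const_mul_le hu h0 h1 hε0.le).trans_lt hεδ)
  have hF0 : Fres Ω f (fun _ => 0) = V * f 0 := by
    simp only [Fres, uX, uY, hV, fderiv_fun_const, Pi.zero_apply, zero_apply,
      setIntegral_const, smul_eq_mul]
    rfl
  have hconst : ∀ a : ℝ, IntegrableOn (fun _ : ℝ × ℝ => a) Ω := fun a =>
    integrableOn_const hbdd.measure_lt_top.ne
  have hiL : IntegrableOn (fun q => L (uX u q, uY u q)) Ω :=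
    integrableOn_comp_gradient hbdd L.continuous hu
  have hiB : IntegrableOn (fun q => B (uX u q, uY u q) (uX u q, uY u q)) Ω :=
    integrableOn_comp_gradient hbdd
      (B.continuous.clm_apply continuous_id : Continuous fun ν => B ν ν) hu
  have hLzero : ∫ q in Ω, L (uX u q, uY u q) = 0 := by
    obtain ⟨m, rfl⟩ := exists_eq_dotL L
    rw [← integral_fderiv_apply_eq_zero hbdd hu h0 hout m]
    congr 1 with q
    rw [fderiv_eq_dotL, dotL_apply, dotL_apply]
    ring
  have hiS : IntegrableOn (fun q => f 0 + κ * (ε ^ 2 * C ^ 2) + ε * L (uX u q, uY u q)) Ω :=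
    (hconst _).add (hiL.const_mul ε)
  have hFu : Fres Ω f (fun x => ε * u x) ≤
      V * (f 0 + κ * (ε ^ 2 * C ^ 2)) + ε * 0 + ε ^ 2 / 2 * I := by
    rw [← hLzero, hI, hV, ← smul_eq_mul (volume.real Ω), ← setIntegral_const,
      ← integral_const_mul, ← integral_const_mul, ← integral_add (hconst _) (hiL.const_mul ε),
      ← integral_add hiS (hiB.const_mul (ε ^ 2 / 2))]
    unfold Fres
    simp only [gradient_const_mul]
    refine integral_mono (integrableOn_comp_gradient hbdd (hf.comp (continuous_const_smul ε)) hu)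
      (hiS.add (hiB.const_mul (ε ^ 2 / 2))) fun q => ?_
    have hg := norm_gradient_le hu q
    set g := (uX u q, uY u q) with hgdef
    have hn : ‖ε • g‖ ≤ ε * C := by
      rw [norm_smul, Real.norm_of_nonneg hε0.le]
      exact mul_le_mul_of_nonneg_left hg hε0.le
    have h := hρT (y := ε • g) (by rw [dist_zero_right]; linarith)
    rw [Real.norm_of_nonneg (sq_nonneg ‖ε • g‖)] at h
    have h2 := (le_abs_self _).trans h
    simp only [map_smul, smul_apply, smul_eq_mul] at h2
    have h3 : ‖ε • g‖ ^ 2 ≤ ε ^ 2 * C ^ 2 := by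
      rw [← mul_pow]; gcongr
    have h4 := mul_le_mul_of_nonneg_left h3 hκ0.le
    simp only
    linarith
  rw [hF0] at hF
  have := mul_le_mul_of_nonneg_left hκI (sq_nonneg ε)
  nlinarith [mul_neg_of_pos_of_neg (sq_pos_of_pos hε0) hneg]

/-- If `∂Ω` contains at most one singular point and `f''(0,0)` is indefinite, then
`u ≡ 0` is not a local minimum. -/
theorem stmt8 (Ω : Set (ℝ × ℝ)) (hconv : Convex ℝ Ω) (hbdd : Bornology.IsBounded Ω)
    (hint : (interior Ω).Nonempty)
    (hsing : ∀ ξ₁ ξ₂ : ℝ × ℝ, IsSingularPoint Ω ξ₁ → IsSingularPoint Ω ξ₂ → ξ₁ = ξ₂)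
    (f : ℝ × ℝ → ℝ) (hf : Continuous f)
    (L : ℝ × ℝ →L[ℝ] ℝ) (B : ℝ × ℝ →L[ℝ] ℝ × ℝ →L[ℝ] ℝ)
    (hsymm : ∀ v w : ℝ × ℝ, B v w = B w v)
    (hTaylor : (fun ζ : ℝ × ℝ => f ζ - f 0 - L ζ - (1 / 2) * B ζ ζ)
        =o[nhds (0 : ℝ × ℝ)] fun ζ : ℝ × ℝ => ‖ζ‖ ^ 2)
    (hpos : ∃ v : ℝ × ℝ, 0 < B v v) (hneg : ∃ w : ℝ × ℝ, B w w < 0) :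
    ¬ ZeroIsLocalMin Ω f := by
  obtain ⟨w, hw⟩ := hneg
  have hw0 : w ≠ 0 := by rintro rfl; simp at hw
  obtain ⟨ξ, n, hξ, hn1, ⟨r, hr, rfl⟩, hn, hreg⟩ := exists_regular_support hbdd hint hsing hw0
  have hB : B (r • w) (r • w) < 0 := by
    simp only [map_smul, smul_apply, smul_eq_mul]
    rw [← mul_assoc]
    exact mul_neg_of_pos_of_neg (mul_self_pos.2 hr) hw
  obtain ⟨u, C, hu, h0, h1, hout, hfr, hconc, hI⟩ :=
    exists_neg_energy hconv hbdd hint hξ hn1 hn hreg B hB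
  exact not_zeroIsLocalMin_of_neg_energy hbdd hf hTaylor hu h0 h1 hout hfr hconc hI
end
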